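/- arXiv:2111.02731 — 7 statements merged into one kernel-verified Lean document; each statement's English description precedes it below -/
import Mathlib

section
/- Let α ∈ (0,1) and z > 0. For every integer k ≥ 1, the probability that the number of blocks K(α,z,n) under the negative Binomial compound Poisson sampling model equals k converges, as n → ∞, to the probability that 1 + P_z equals k, where P_z is a Poisson random variable with parameter z. Explicitly: lim_{n→∞} 𝒞(n,k;α) z^k / (∑_{j=1}^n 𝒞(n,j;α) z^j) = e^{-z} z^{k-1} / (k-1)! for every integer k ≥ 1. -/
open Finset Filter Real MeasureTheory Topology Set

/-- Ascending factorial `(x)_{(n)} = x (x+1) ⋯ (x+n-1)`. -/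
noncomputable def ascFact (x : ℝ) (n : ℕ) : ℝ := ∏ i ∈ Finset.range n, (x + i)

/-- Falling factorial `(a)_{[n]} = a (a-1) ⋯ (a-n+1)`. -/
noncomputable def fallFact (a : ℝ) (n : ℕ) : ℝ := ∏ i ∈ Finset.range n, (a - i)

/-- Generalized factorial coefficient
`𝒞(n,j;α) = (1/j!) ∑_{i=0}^{j} C(j,i) (-1)^i (-iα)_{(n)}`. -/
noncomputable def genFact (n j : ℕ) (α : ℝ) : ℝ :=
  (1 / (Nat.factorial j : ℝ)) *
    ∑ i ∈ Finset.range (j + 1), (Nat.choose j i : ℝ) * (-1) ^ i * ascFact (-(i * α)) n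

lemma ascFact_succ (x : ℝ) (n : ℕ) : ascFact x (n + 1) = ascFact x n * (x + n) :=
  Finset.prod_range_succ _ _

lemma ascFact_eq_zero {m n : ℕ} (h : m < n) : ascFact (-(m : ℝ)) n = 0 :=
  Finset.prod_eq_zero (Finset.mem_range.2 h) (by simp)

lemma genFact_succ_zero (n : ℕ) (α : ℝ) : genFact (n + 1) 0 α = 0 := by
  have := ascFact_eq_zero (Nat.succ_pos n)
  simp_all [genFact]

lemma genFact_zero_succ (j : ℕ) (α : ℝ) : genFact 0 (j + 1) α = 0 := by
  have h := add_pow (-1 : ℝ) 1 (j + 1)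
  simp only [neg_add_cancel, one_pow, mul_one, ne_eq, Nat.succ_ne_zero, not_false_eq_true,
    zero_pow] at h
  simp only [genFact, ascFact, Finset.range_zero, Finset.prod_empty, mul_one]
  rw [Finset.sum_congr rfl fun i _ => mul_comm _ _, ← h, mul_zero]

/-- The triangular recurrence of the generalized factorial coefficients. -/
lemma genFact_succ_succ (n j : ℕ) (α : ℝ) :
    genFact (n + 1) (j + 1) α =
      (n - (j + 1) * α) * genFact n (j + 1) α + α * genFact n j α := by
  have hj : ((j + 1).factorial : ℝ) = (j + 1) * j.factorial := by
    push_cast [Nat.factorial_succ]; ring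
  have hj0 : (j.factorial : ℝ) ≠ 0 := by positivity
  have hj1 : (j + 1 : ℝ) ≠ 0 := by positivity
  have key : ∑ i ∈ Finset.range (j + 1 + 1), ((j + 1).choose i : ℝ) * (-1) ^ i *
        ascFact (-(i * α)) (n + 1) =
      (n - (j + 1) * α) * ∑ i ∈ Finset.range (j + 1 + 1), ((j + 1).choose i : ℝ) * (-1) ^ i *
        ascFact (-(i * α)) n +
      (j + 1) * α * ∑ i ∈ Finset.range (j + 1), (j.choose i : ℝ) * (-1) ^ i *
        ascFact (-(i * α)) n := by
    have h : ∑ i ∈ Finset.range (j + 1), (j.choose i : ℝ) * (-1) ^ i * ascFact (-(i * α)) n =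
        ∑ i ∈ Finset.range (j + 1 + 1), (j.choose i : ℝ) * (-1) ^ i * ascFact (-(i * α)) n := by
      rw [Finset.sum_range_succ _ (j + 1)]
      simp
    rw [h, Finset.mul_sum, Finset.mul_sum, ← Finset.sum_add_distrib]
    refine Finset.sum_congr rfl fun i hi => ?_
    have hi' : i ≤ j + 1 := Nat.lt_succ_iff.1 (Finset.mem_range.1 hi)
    have hc : (j.choose i : ℝ) * (j + 1) = (j + 1).choose i * (j + 1 - i) := by
      have := Nat.choose_mul_succ_eq j i
      have h2 := congrArg (Nat.cast (R := ℝ)) this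
      push_cast [Nat.cast_sub hi'] at h2
      exact h2
    rw [ascFact_succ]
    linear_combination (-1 : ℝ) * α * (-1) ^ i * ascFact (-(i * α)) n * hc
  simp only [genFact, key, hj]
  field_simp

lemma genFact_eq_zero_of_lt {n j : ℕ} (h : n < j) (α : ℝ) : genFact n j α = 0 := by
  induction n generalizing j with
  | zero =>
    obtain ⟨j, rfl⟩ := Nat.exists_eq_succ_of_ne_zero h.ne'
    exact genFact_zero_succ j α
  | succ n ih =>
    obtain ⟨j, rfl⟩ := Nat.exists_eq_succ_of_ne_zero (Nat.ne_zero_of_lt h)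
    rw [genFact_succ_succ, ih (by omega), ih (by omega)]
    ring

lemma genFact_one_eq {n : ℕ} (hn : 0 < n) (α : ℝ) : genFact n 1 α = -ascFact (-α) n := by
  have := ascFact_eq_zero hn
  simp_all [genFact, Finset.sum_range_succ]

lemma genFact_succ_one_pos {α : ℝ} (hα : α ∈ Set.Ioo (0 : ℝ) 1) (n : ℕ) :
    0 < genFact (n + 1) 1 α := by
  induction n with
  | zero => simpa [genFact_one_eq, ascFact] using hα.1
  | succ n ih =>
    have h := genFact_succ_succ (n + 1) 0 α
    rw [genFact_succ_zero] at h
    rw [h]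
    have : (0 : ℝ) < (n + 1 : ℕ) - ((0 : ℕ) + 1) * α := by
      push_cast
      linarith [hα.2, (Nat.cast_nonneg n : (0 : ℝ) ≤ n)]
    simpa using mul_pos this ih

lemma sub_mul_genFact_nonneg {α : ℝ} (hα : α ∈ Set.Ioo (0 : ℝ) 1) {n j : ℕ} {y : ℝ}
    (hy : 0 ≤ y) (h0 : n < j → y = 0) : 0 ≤ (n - j * α) * y := by
  rcases lt_or_ge n j with h | h
  · simp [h0 h]
  · have : (j : ℝ) ≤ n := by exact_mod_cast h
    exact mul_nonneg (by nlinarith [hα.1, hα.2, (Nat.cast_nonneg j : (0 : ℝ) ≤ j)]) hy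

lemma genFact_nonneg {α : ℝ} (hα : α ∈ Set.Ioo (0 : ℝ) 1) (n j : ℕ) :
    0 ≤ genFact (n + 1) j α := by
  induction n generalizing j with
  | zero =>
    match j with
    | 0 => exact (genFact_succ_zero 0 α).ge
    | 1 => exact (genFact_succ_one_pos hα 0).le
    | j + 2 => exact (genFact_eq_zero_of_lt (by omega) α).ge
  | succ n ih =>
    cases j with
    | zero => exact (genFact_succ_zero _ α).ge
    | succ j =>
      rw [genFact_succ_succ]
      have := sub_mul_genFact_nonneg hα (n := n + 1) (ih (j + 1))
        fun h => genFact_eq_zero_of_lt h α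
      push_cast at this ⊢
      exact add_nonneg this (mul_nonneg hα.1.le (ih j))

lemma factorial_mul_genFact_le {α : ℝ} (hα : α ∈ Set.Ioo (0 : ℝ) 1) (n j : ℕ) :
    j.factorial * (1 - α) ^ j * genFact (n + 1) (j + 1) α ≤ genFact (n + 1) 1 α := by
  obtain ⟨hα0, hα1⟩ := hα
  induction n generalizing j with
  | zero =>
    cases j with
    | zero => simp
    | succ j =>
      rw [genFact_eq_zero_of_lt (by omega), mul_zero]
      exact genFact_nonneg ⟨hα0, hα1⟩ 0 1
  | succ n ih =>
    cases j with
    | zero => simp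
    | succ j =>
      have hc := genFact_nonneg ⟨hα0, hα1⟩ n 1
      have hn : (0 : ℝ) ≤ n := n.cast_nonneg
      have hj : (0 : ℝ) ≤ j := j.cast_nonneg
      have h1 : genFact (n + 1 + 1) 1 α = (n + 1 - α) * genFact (n + 1) 1 α := by
        have h := genFact_succ_succ (n + 1) 0 α
        rw [genFact_succ_zero] at h
        simpa using h
      have hrec : (j + 1).factorial * (1 - α) ^ (j + 1) * genFact (n + 1 + 1) (j + 1 + 1) α =
          (n + 1 - (j + 2) * α) *
            ((j + 1).factorial * (1 - α) ^ (j + 1) * genFact (n + 1) (j + 1 + 1) α) +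
          α * (j + 1) * (1 - α) * (j.factorial * (1 - α) ^ j * genFact (n + 1) (j + 1) α) := by
        rw [genFact_succ_succ, Nat.factorial_succ]
        push_cast
        ring
      have hcoef : 0 ≤ α * (j + 1) * (1 - α) :=
        mul_nonneg (by positivity) (sub_nonneg.2 hα1.le)
      have hB := mul_le_mul_of_nonneg_left (ih j) hcoef
      rw [h1, hrec]
      rcases lt_trichotomy n j with h | rfl | h
      · rw [genFact_eq_zero_of_lt (by omega), genFact_eq_zero_of_lt (by omega)]
        have := mul_nonneg (show 0 ≤ n + 1 - α by linarith) hc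
        linarith
      · rw [genFact_eq_zero_of_lt (j := n + 1 + 1) (by omega)]
        have := mul_le_mul_of_nonneg_right
          (show α * (n + 1) * (1 - α) ≤ n + 1 - α by
            nlinarith [mul_nonneg hn (sq_nonneg (1 - α)), mul_nonneg hn hα0.le,
              sq_nonneg (1 - α)]) hc
        linarith
      · have hle : (j : ℝ) + 1 ≤ n := by exact_mod_cast h
        have hA := mul_le_mul_of_nonneg_left (ih (j + 1))
          (show 0 ≤ n + 1 - (j + 2) * α by nlinarith)
        have := mul_le_mul_of_nonneg_right
          (show n + 1 - (j + 2) * α + α * (j + 1) * (1 - α) ≤ n + 1 - α by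
            nlinarith [mul_nonneg (sq_nonneg α) hj]) hc
        linarith

lemma tendsto_ascFact_div {α β : ℝ} (hα : α ∈ Set.Ioo (0 : ℝ) 1) (hαβ : α < β) :
    Tendsto (fun n : ℕ => ascFact (-β) (n + 1) / ascFact (-α) (n + 1)) atTop (𝓝 0) := by
  by_cases hβ : ∃ m : ℕ, β = m
  · obtain ⟨m, rfl⟩ := hβ
    refine tendsto_const_nhds.congr' ?_
    filter_upwards [eventually_ge_atTop m] with n hn
    rw [ascFact_eq_zero (by omega), zero_div]
  · push Not at hβ
    have hΓ : Real.Gamma (-β) ≠ 0 := Real.Gamma_ne_zero fun m h => hβ m (neg_injective h)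
    have h := ((Real.GammaSeq_tendsto_Gamma (-α)).div (Real.GammaSeq_tendsto_Gamma (-β)) hΓ).mul
      ((tendsto_rpow_neg_atTop (sub_pos.2 hαβ)).comp tendsto_natCast_atTop_atTop)
    rw [mul_zero] at h
    refine h.congr' ?_
    filter_upwards [eventually_gt_atTop 0] with n hn
    have hn' : (0 : ℝ) < n := by exact_mod_cast hn
    have hne : ∀ m : ℕ, -α ≠ -m := by
      rintro m hm
      have h1 : α = m := neg_injective hm
      have h2 := hα.1
      have h3 := hα.2
      rw [h1] at h2 h3
      norm_cast at h2 h3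
      omega
    have hA : ascFact (-α) (n + 1) ≠ 0 :=
      Finset.prod_ne_zero_iff.2 fun i _ hi => hne i (eq_neg_of_add_eq_zero_left hi)
    have hB : ascFact (-β) (n + 1) ≠ 0 :=
      Finset.prod_ne_zero_iff.2 fun i _ hi =>
        hβ i (neg_injective (eq_neg_of_add_eq_zero_left hi))
    have hf : (n.factorial : ℝ) ≠ 0 := by positivity
    have hp : (n : ℝ) ^ (-α) ≠ 0 := (Real.rpow_pos_of_pos hn' _).ne'
    have hq : (n : ℝ) ^ (-β) ≠ 0 := (Real.rpow_pos_of_pos hn' _).ne'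
    have hpow : (n : ℝ) ^ (-(β - α)) = (n : ℝ) ^ (-β) / (n : ℝ) ^ (-α) := by
      rw [← Real.rpow_sub hn']
      ring_nf
    simp only [Pi.div_apply, Function.comp_apply, Real.GammaSeq, hpow]
    change (n : ℝ) ^ (-α) * n.factorial / ascFact (-α) (n + 1) /
      ((n : ℝ) ^ (-β) * n.factorial / ascFact (-β) (n + 1)) * _ = _
    field_simp

lemma tendsto_genFact_div {α : ℝ} (hα : α ∈ Set.Ioo (0 : ℝ) 1) (j : ℕ) :
    Tendsto (fun n : ℕ => genFact (n + 1) (j + 1) α / genFact (n + 1) 1 α) atTop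
      (𝓝 (1 / j.factorial)) := by
  have hterm : ∀ i ∈ Finset.range (j + 1 + 1),
      Tendsto (fun n : ℕ => ((j + 1).choose i : ℝ) * (-1) ^ i *
        (-(ascFact (-(i * α)) (n + 1) / ascFact (-α) (n + 1)))) atTop
        (𝓝 (if i = 1 then (j + 1 : ℝ) else 0)) := by
    intro i _
    match i with
    | 0 =>
      have h0 (n : ℕ) := ascFact_eq_zero (Nat.succ_pos n)
      simp_all
    | 1 =>
      refine tendsto_const_nhds.congr fun n => ?_
      have h := (genFact_succ_one_pos hα n).ne'
      rw [genFact_one_eq n.succ_pos, neg_ne_zero] at h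
      simp [h]
    | i + 2 =>
      have h := (tendsto_ascFact_div hα (β := (i + 2 : ℕ) * α) (by
        push_cast
        nlinarith [hα.1, mul_nonneg (Nat.cast_nonneg i : (0 : ℝ) ≤ i) hα.1.le])).neg.const_mul
        (((j + 1).choose (i + 2) : ℝ) * (-1) ^ (i + 2))
      simpa using h
  have hsum := (tendsto_finsetSum _ hterm).const_mul (1 / ((j + 1).factorial : ℝ))
  have hlim : 1 / ((j + 1).factorial : ℝ) *
      ∑ i ∈ Finset.range (j + 1 + 1), (if i = 1 then (j + 1 : ℝ) else 0) = 1 / j.factorial := by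
    rw [Finset.sum_ite_eq' (Finset.range (j + 1 + 1)) 1, if_pos (by simp), Nat.factorial_succ]
    push_cast
    field_simp
  rw [hlim] at hsum
  refine hsum.congr fun n => ?_
  rw [genFact_one_eq n.succ_pos, genFact, mul_div_assoc, Finset.sum_div]
  congr 1
  refine Finset.sum_congr rfl fun i _ => ?_
  rw [div_neg]
  ring

/-- The normalizing constants, divided by `𝒞(n,1;α)`, converge to `z e^z`. -/
lemma tendsto_sum_genFact_div {α z : ℝ} (hα : α ∈ Set.Ioo (0 : ℝ) 1) (hz : 0 < z) :
    Tendsto (fun n : ℕ => (∑ j ∈ Finset.Icc 1 (n + 1), genFact (n + 1) j α * z ^ j) /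
      genFact (n + 1) 1 α) atTop (𝓝 (z * Real.exp z)) := by
  have hs : HasSum (fun j : ℕ => 1 / (j.factorial : ℝ) * z ^ (j + 1)) (z * Real.exp z) := by
    have h := (NormedSpace.expSeries_div_hasSum_exp (𝔸 := ℝ) z).mul_left z
    rw [← Real.exp_eq_exp_ℝ] at h
    exact h.congr_fun fun j => by ring
  have hα1 : 0 < 1 - α := sub_pos.2 hα.2
  have hb : Summable fun j : ℕ => 1 / (j.factorial * (1 - α) ^ j) * z ^ (j + 1) :=
    ((Real.summable_pow_div_factorial (z / (1 - α))).mul_left z).congr fun j => by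
      rw [div_pow, pow_succ']
      field_simp
  have h := tendsto_tsum_of_dominated_convergence hb
    (fun j => (tendsto_genFact_div hα j).mul_const (z ^ (j + 1)))
    (Eventually.of_forall fun n j => by
      have hpos := genFact_succ_one_pos hα n
      have hnn := genFact_nonneg hα n (j + 1)
      rw [Real.norm_of_nonneg (by positivity)]
      refine mul_le_mul_of_nonneg_right ?_ (by positivity)
      rw [div_le_div_iff₀ hpos (by positivity), one_mul, mul_comm]
      exact factorial_mul_genFact_le hα n j)
  rw [hs.tsum_eq] at h
  refine h.congr fun n => ?_
  rw [tsum_eq_sum (s := Finset.range (n + 1)) fun j hj => by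
    rw [genFact_eq_zero_of_lt (by simpa using hj)]; simp]
  rw [Finset.sum_div, ← Finset.Ico_add_one_right_eq_Icc, Finset.sum_Ico_eq_sum_range]
  refine Finset.sum_congr (by simp) fun j _ => ?_
  rw [add_comm 1 j]
  ring

/-- under the NB-CPSM with `α ∈ (0,1)` and `z > 0`, for every `k ≥ 1`,
`Pr[K(α,z,n) = k] = 𝒞(n,k;α) z^k / ∑_{j=1}^n 𝒞(n,j;α) z^j` converges, as `n → ∞`,
to `Pr[1 + P_z = k] = e^{-z} z^{k-1}/(k-1)!`. -/
theorem nbcpsm_blocks_tendsto_shifted_poisson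
    (α z : ℝ) (hα : α ∈ Set.Ioo (0 : ℝ) 1) (hz : 0 < z) (k : ℕ) (hk : 1 ≤ k) :
    Tendsto (fun n : ℕ =>
        genFact n k α * z ^ k / ∑ j ∈ Finset.Icc 1 n, genFact n j α * z ^ j)
      atTop
      (𝓝 (Real.exp (-z) * z ^ (k - 1) / (Nat.factorial (k - 1)))) := by
  obtain ⟨j, rfl⟩ := Nat.exists_eq_add_of_le' hk
  rw [← tendsto_add_atTop_iff_nat 1]
  have h := ((tendsto_genFact_div hα j).mul_const (z ^ (j + 1))).div
    (tendsto_sum_genFact_div hα hz) (by positivity)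
  have hlim : 1 / (j.factorial : ℝ) * z ^ (j + 1) / (z * Real.exp z) =
      Real.exp (-z) * z ^ (j + 1 - 1) / ((j + 1 - 1).factorial : ℝ) := by
    rw [Real.exp_neg, Nat.add_sub_cancel, pow_succ]
    field_simp
  rw [hlim] at h
  refine h.congr fun n => ?_
  have hpos := (genFact_succ_one_pos hα n).ne'
  simp only [Pi.div_apply]
  rw [div_mul_eq_mul_div, div_div_div_cancel_right₀ hpos]
end

section
/- Let σ > 0 and ζ > 0, and set γ := σ/(1+σ) and c := (σζ)^{1/(1+σ)}/σ. Then the number of blocks K(-σ,-ζ,n) under the NB-CPSM with parameters α = -σ and z = -ζ, rescaled by n^{γ}, converges in probability to the constant c: for every ε > 0, lim_{n→∞} ∑_{k ∈ {1,…,n} : |k·n^{-γ} - c| > ε} 𝒞(n,k;-σ)(-ζ)^k / (∑_{j=1}^n 𝒞(n,j;-σ)(-ζ)^j) = 0. -/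
open Finset Filter Real MeasureTheory Topology Set

lemma hasSum_ascFact_div_factorial (a : ℝ) {x : ℝ} (hx0 : 0 < x) (hx1 : x < 1) :
    HasSum (fun n : ℕ => ascFact a n / (n.factorial : ℝ) * x ^ n) ((1 - x) ^ (-a)) := by
  have asc : ∀ n : ℕ, (ascPochhammer ℝ n).eval a = ascFact a n := by
    intro n
    induction n with
    | zero => simp [ascFact]
    | succ n ih => rw [ascPochhammer_succ_eval, ih, ascFact, ascFact, Finset.prod_range_succ]
  have h := (Real.one_div_one_sub_rpow_hasFPowerSeriesOnBall_zero a).hasSum (y := x) (by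
    rw [Metric.mem_eball, edist_zero_right, ← ofReal_norm, Real.norm_of_nonneg hx0.le]
    exact ENNReal.ofReal_lt_one.2 hx1)
  rw [zero_add, one_div, ← Real.rpow_neg (by linarith)] at h
  refine h.congr_fun fun n => ?_
  rw [FormalMultilinearSeries.ofScalars_apply_eq, ← Ring.multichoose_eq, smul_eq_mul]
  congr 1
  rw [← asc, ← Polynomial.ascPochhammer_smeval_eq_eval,
    ← Ring.factorial_nsmul_multichoose_eq_ascPochhammer, nsmul_eq_mul]
  field_simp

/-- The signless generalized factorial coefficient `(-1)^k 𝒞(n,k;-σ)`. -/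
noncomputable def signlessGenFact (σ : ℝ) (n k : ℕ) : ℝ :=
  (-1) ^ k * genFact n k (-σ)

lemma genFact_mul_neg_pow (σ z : ℝ) (n k : ℕ) :
    genFact n k (-σ) * (-z) ^ k = signlessGenFact σ n k * z ^ k := by
  rw [signlessGenFact, neg_pow]
  ring

lemma signlessGenFact_eq (σ : ℝ) (n k : ℕ) :
    signlessGenFact σ n k = (-1) ^ k / (k.factorial : ℝ) *
      ∑ i ∈ Finset.range (k + 1), (k.choose i : ℝ) * (-1) ^ i * ascFact (i * σ) n := by
  simp only [signlessGenFact, genFact, mul_neg, neg_neg]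
  ring

lemma signlessGenFact_succ_zero (σ : ℝ) (n : ℕ) : signlessGenFact σ (n + 1) 0 = 0 := by
  simp [signlessGenFact_eq, ascFact, Finset.prod_range_succ']

lemma signlessGenFact_zero_succ (σ : ℝ) (k : ℕ) : signlessGenFact σ 0 (k + 1) = 0 := by
  have h := add_pow (-1 : ℝ) 1 (k + 1)
  simp only [one_pow, mul_one, neg_add_cancel, ne_eq, Nat.succ_ne_zero, not_false_eq_true,
    zero_pow] at h
  simp only [signlessGenFact_eq, ascFact, Finset.range_zero, Finset.prod_empty, mul_one]
  rw [mul_eq_zero]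
  right
  rw [h]
  exact Finset.sum_congr rfl fun i _ => mul_comm _ _

lemma signlessGenFact_succ_succ (σ : ℝ) (n k : ℕ) :
    signlessGenFact σ (n + 1) (k + 1) =
      (n + σ * (k + 1)) * signlessGenFact σ n (k + 1) + σ * signlessGenFact σ n k := by
  have hch : ∀ i ∈ Finset.range (k + 2), ((k + 1).choose i : ℝ) * (-1) ^ i *
      ascFact (i * σ) (n + 1) =
      (n + σ * (k + 1)) * (((k + 1).choose i : ℝ) * (-1) ^ i * ascFact (i * σ) n) -
      σ * (k + 1) * ((k.choose i : ℝ) * (-1) ^ i * ascFact (i * σ) n) := by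
    intro i hi
    have hi : i ≤ k + 1 := by simpa [Nat.lt_succ_iff] using hi
    have h' : ((k + 1).choose i : ℝ) * (k + 1 - i) = (k + 1) * (k.choose i : ℝ) := by
      have := Nat.choose_mul_succ_eq k i
      have e : ((k + 1 - i : ℕ) : ℝ) = k + 1 - i := by push_cast [Nat.cast_sub hi]; ring
      rw [← e]
      exact_mod_cast (by linarith : (k + 1).choose i * (k + 1 - i) = (k + 1) * k.choose i)
    have e : ascFact (i * σ) (n + 1) = ascFact (i * σ) n * (i * σ + n) := by
      rw [ascFact, ascFact, Finset.prod_range_succ]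
    rw [e]
    linear_combination (-σ * (-1) ^ i * ascFact (i * σ) n) * h'
  rw [signlessGenFact_eq, signlessGenFact_eq, signlessGenFact_eq, Finset.sum_congr rfl hch,
    Finset.sum_sub_distrib, ← Finset.mul_sum, ← Finset.mul_sum,
    Finset.sum_range_succ (fun i : ℕ => (k.choose i : ℝ) * (-1) ^ i * ascFact (i * σ) n) (k + 1),
    Nat.choose_succ_self, Nat.factorial_succ]
  push_cast
  field_simp
  ring

lemma signlessGenFact_nonneg {σ : ℝ} (hσ : 0 ≤ σ) (n k : ℕ) : 0 ≤ signlessGenFact σ n k := by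
  induction n generalizing k with
  | zero =>
    cases k with
    | zero => simp [signlessGenFact_eq, ascFact]
    | succ k => rw [signlessGenFact_zero_succ]
  | succ n ih =>
    cases k with
    | zero => rw [signlessGenFact_succ_zero]
    | succ k =>
      rw [signlessGenFact_succ_succ]
      have := ih (k + 1)
      have := ih k
      positivity

lemma signlessGenFact_eq_zero_of_lt (σ : ℝ) {n k : ℕ} (h : n < k) : signlessGenFact σ n k = 0 := by
  induction n generalizing k with
  | zero =>
    obtain ⟨k, rfl⟩ := Nat.exists_eq_succ_of_ne_zero h.ne'
    exact signlessGenFact_zero_succ σ k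
  | succ n ih =>
    obtain ⟨k, rfl⟩ := Nat.exists_eq_succ_of_ne_zero (Nat.ne_zero_of_lt h)
    rw [Nat.succ_eq_add_one, signlessGenFact_succ_succ, ih (by omega), ih (by omega)]
    simp

/-- The coefficient of `x ^ n` in `exp (z * ((1 - x) ^ (-σ) - 1))`. -/
noncomputable def blockWeight (σ z : ℝ) (n : ℕ) : ℝ :=
  (∑ k ∈ Finset.range (n + 1), signlessGenFact σ n k * z ^ k) / (n.factorial : ℝ)

lemma blockWeight_nonneg {σ z : ℝ} (hσ : 0 ≤ σ) (hz : 0 ≤ z) (n : ℕ) : 0 ≤ blockWeight σ z n :=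
  div_nonneg (Finset.sum_nonneg fun k _ =>
    mul_nonneg (signlessGenFact_nonneg hσ n k) (pow_nonneg hz k)) (by positivity)

lemma mul_blockWeight_le_succ {σ z : ℝ} (hσ : 0 ≤ σ) (hz : 0 ≤ z) (n : ℕ) :
    n * blockWeight σ z n ≤ ((n + 1 : ℕ) : ℝ) * blockWeight σ z (n + 1) := by
  have hnn := signlessGenFact_nonneg hσ
  have key : n * ∑ k ∈ Finset.range (n + 1), signlessGenFact σ n k * z ^ k ≤
      ∑ k ∈ Finset.range (n + 1 + 1), signlessGenFact σ (n + 1) k * z ^ k := by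
    rw [Finset.sum_range_succ' _ (n + 1), signlessGenFact_succ_zero, zero_mul, add_zero,
      Finset.sum_range_succ']
    cases n with
    | zero =>
      simp only [Nat.cast_zero, zero_mul]
      exact Finset.sum_nonneg fun k _ => mul_nonneg (hnn _ _) (pow_nonneg hz _)
    | succ n =>
      rw [signlessGenFact_succ_zero, zero_mul, add_zero, Finset.mul_sum]
      refine (Finset.sum_le_sum fun k _ => ?_).trans
        (Finset.sum_le_sum_of_subset_of_nonneg (Finset.range_subset_range.2 (Nat.le_succ _))
          fun k _ _ => mul_nonneg (hnn _ _) (pow_nonneg hz _))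
      rw [signlessGenFact_succ_succ σ (n + 1) k, ← mul_assoc]
      refine mul_le_mul_of_nonneg_right ?_ (pow_nonneg hz _)
      have h1 := hnn (n + 1) (k + 1)
      have h2 := hnn (n + 1) k
      have : 0 ≤ σ * (k + 1) * signlessGenFact σ (n + 1) (k + 1) := by positivity
      have : 0 ≤ σ * signlessGenFact σ (n + 1) k := by positivity
      linarith
  rw [blockWeight, blockWeight, Nat.factorial_succ]
  push_cast
  have : ((n : ℝ) + 1) * ((∑ k ∈ Finset.range (n + 1 + 1), signlessGenFact σ (n + 1) k * z ^ k) /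
      ((n + 1) * (n.factorial : ℝ))) =
      (∑ k ∈ Finset.range (n + 1 + 1), signlessGenFact σ (n + 1) k * z ^ k) / n.factorial := by
    field_simp
  rw [this, ← mul_div_assoc]
  gcongr

lemma monotone_mul_blockWeight {σ z : ℝ} (hσ : 0 ≤ σ) (hz : 0 ≤ z) :
    Monotone fun n : ℕ => n * blockWeight σ z n :=
  monotone_nat_of_le_succ (mul_blockWeight_le_succ hσ hz)

lemma hasSum_signlessGenFact (σ : ℝ) (k : ℕ) {x : ℝ} (hx0 : 0 < x) (hx1 : x < 1) :
    HasSum (fun n : ℕ => signlessGenFact σ n k / (n.factorial : ℝ) * x ^ n)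
      (((1 - x) ^ (-σ) - 1) ^ k / (k.factorial : ℝ)) := by
  have h := (hasSum_sum (s := Finset.range (k + 1)) fun i _ =>
    (hasSum_ascFact_div_factorial (i * σ) hx0 hx1).mul_left ((k.choose i : ℝ) * (-1) ^ i)).mul_left
      ((-1) ^ k / (k.factorial : ℝ))
  have hval : ((1 - x) ^ (-σ) - 1) ^ k / (k.factorial : ℝ) = (-1) ^ k / (k.factorial : ℝ) *
      ∑ i ∈ Finset.range (k + 1), (k.choose i : ℝ) * (-1) ^ i * (1 - x) ^ (-(i * σ)) := by
    have e : ((1 - x) ^ (-σ) - 1) ^ k = (-1) ^ k * (-(1 - x) ^ (-σ) + 1) ^ k := by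
      rw [← mul_pow]; ring
    rw [e, add_pow, mul_div_right_comm]
    congr 1
    refine Finset.sum_congr rfl fun i _ => ?_
    rw [← mul_neg, mul_comm (i : ℝ), Real.rpow_mul (by linarith), Real.rpow_natCast, neg_pow]
    ring
  rw [hval]
  refine h.congr_fun fun n => ?_
  rw [signlessGenFact_eq]
  simp only [div_eq_mul_inv, Finset.mul_sum, Finset.sum_mul]
  exact Finset.sum_congr rfl fun i _ => by ring

lemma hasSum_blockWeight {σ z : ℝ} (hσ : 0 ≤ σ) (hz : 0 ≤ z) {x : ℝ} (hx0 : 0 < x) (hx1 : x < 1) :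
    HasSum (fun n : ℕ => blockWeight σ z n * x ^ n) (exp (z * ((1 - x) ^ (-σ) - 1))) := by
  set g := (1 - x) ^ (-σ) - 1
  let f : ℕ × ℕ → ℝ := fun p => z ^ p.1 * (signlessGenFact σ p.2 p.1 / p.2.factorial * x ^ p.2)
  have hf0 : 0 ≤ f := fun p => by
    have := signlessGenFact_nonneg hσ p.2 p.1
    simp only [f, Pi.zero_apply]
    positivity
  have hrow : ∀ k, HasSum (fun n => f (k, n)) (z ^ k * (g ^ k / k.factorial)) := fun k =>
    (hasSum_signlessGenFact σ k hx0 hx1).mul_left _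
  have hexp : HasSum (fun k : ℕ => z ^ k * (g ^ k / k.factorial)) (exp (z * g)) := by
    have := NormedSpace.expSeries_div_hasSum_exp (z * g)
    rw [← Real.exp_eq_exp_ℝ] at this
    exact this.congr_fun fun k => by rw [mul_pow]; ring
  have hf : Summable f := by
    refine (summable_prod_of_nonneg hf0).2 ⟨fun k => (hrow k).summable, ?_⟩
    simpa only [(hrow _).tsum_eq] using hexp.summable
  have htot : HasSum f (exp (z * g)) := by
    rw [← (hf.hasSum.prod_fiberwise hrow).unique hexp]
    exact hf.hasSum
  refine ((Equiv.prodComm ℕ ℕ).hasSum_iff.2 htot).prod_fiberwise fun n => ?_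
  have hval : blockWeight σ z n * x ^ n = ∑ k ∈ Finset.range (n + 1), f (k, n) := by
    simp only [f, blockWeight, div_eq_mul_inv, Finset.sum_mul]
    exact Finset.sum_congr rfl fun i _ => by ring
  rw [hval]
  refine hasSum_sum_of_ne_finset_zero (f := fun k => f (k, n)) fun k hk => ?_
  simp only [f]
  rw [signlessGenFact_eq_zero_of_lt σ (by simpa [Nat.lt_succ_iff] using hk)]
  simp

lemma blockWeight_le {σ z : ℝ} (hσ : 0 ≤ σ) (hz : 0 ≤ z) {x : ℝ} (hx0 : 0 < x) (hx1 : x < 1)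
    (n : ℕ) : blockWeight σ z n ≤ exp (z * ((1 - x) ^ (-σ) - 1) - n * log x) := by
  have h := (hasSum_blockWeight hσ hz hx0 hx1).summable.le_tsum n fun m _ =>
    mul_nonneg (blockWeight_nonneg hσ hz m) (pow_nonneg hx0.le m)
  rw [(hasSum_blockWeight hσ hz hx0 hx1).tsum_eq] at h
  rw [Real.exp_sub, Real.exp_nat_mul, Real.exp_log hx0]
  exact (le_div_iff₀ (by positivity)).2 h

/-- A two-sided Chernoff truncation of a power series whose coefficients `A` make `m * A m`
monotone bounds its value by a multiple of a single coefficient. -/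
lemma hasSum_le_of_monotone_mul {A : ℕ → ℝ} (hA : ∀ m, 0 ≤ A m)
    (hmono : Monotone fun m : ℕ => m * A m) {x y z Fx Fy Fz : ℝ} (hzx : z ≤ x) (hxy : x ≤ y)
    (hx : x ≤ 0) (hFx : HasSum (fun m : ℕ => A m * exp (m * x)) Fx)
    (hFy : HasSum (fun m : ℕ => A m * exp (m * y)) Fy)
    (hFz : HasSum (fun m : ℕ => A m * exp (m * z)) Fz) {a : ℝ} (ha : 0 < a) {n : ℕ} (hn : 1 ≤ n) :
    Fx ≤ exp (n * (x - y)) * Fy + exp (a * n * (x - z)) * Fz +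
      (n + 1) * (n * A n * exp (a * n * x)) := by
  have hmid : HasSum (fun m : ℕ => if m ∈ Finset.range (n + 1) then n * A n * exp (a * n * x) else 0)
      ((n + 1) * (n * A n * exp (a * n * x))) := by
    convert hasSum_sum_of_ne_finset_zero (s := Finset.range (n + 1)) (L := .unconditional ℕ) ?_
      using 1
    · rw [Finset.sum_congr rfl fun m hm => if_pos hm]
      simp
    · exact fun m hm => if_neg hm
  refine hasSum_le (fun m => ?_) hFx (((hFy.mul_left _).add (hFz.mul_left _)).add hmid)
  have hy0 : 0 ≤ exp (n * (x - y)) * (A m * exp (m * y)) :=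
    mul_nonneg (exp_pos _).le (mul_nonneg (hA m) (exp_pos _).le)
  have hz0 : 0 ≤ exp (a * n * (x - z)) * (A m * exp (m * z)) :=
    mul_nonneg (exp_pos _).le (mul_nonneg (hA m) (exp_pos _).le)
  have hm0 : 0 ≤ n * A n * exp (a * n * x) :=
    mul_nonneg (mul_nonneg n.cast_nonneg (hA n)) (exp_pos _).le
  by_cases hmn : m ≤ n
  · rw [if_pos (Finset.mem_range.2 (Nat.lt_succ_of_le hmn))]
    by_cases hma : (m : ℝ) < a * n
    · have : A m * exp (m * x) ≤ exp (a * n * (x - z)) * (A m * exp (m * z)) := by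
        rw [mul_left_comm, ← Real.exp_add]
        refine mul_le_mul_of_nonneg_left (Real.exp_le_exp.2 ?_) (hA m)
        nlinarith
      linarith
    · push Not at hma
      have hm1 : (1 : ℝ) ≤ m := by
        have : 0 < (m : ℝ) := lt_of_lt_of_le (by positivity) hma
        exact_mod_cast this
      have : A m * exp (m * x) ≤ n * A n * exp (a * n * x) := by
        refine mul_le_mul ?_ (Real.exp_le_exp.2 ?_) (exp_pos _).le
          (mul_nonneg n.cast_nonneg (hA n))
        · exact (le_mul_of_one_le_left (hA m) hm1).trans (hmono hmn)
        · nlinarith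
      linarith
  · rw [if_neg (by simpa [Nat.lt_succ_iff] using hmn), add_zero]
    have hmn' : (n : ℝ) ≤ m := by exact_mod_cast (not_le.1 hmn).le
    have : A m * exp (m * x) ≤ exp (n * (x - y)) * (A m * exp (m * y)) := by
      rw [mul_left_comm, ← Real.exp_add]
      refine mul_le_mul_of_nonneg_left (Real.exp_le_exp.2 ?_) (hA m)
      nlinarith
    linarith

lemma tendsto_natCast_sq_mul_exp_rpow_mul {γ : ℝ} (hγ : 0 < γ) {b : ℕ → ℝ} {l : ℝ} (hl : l < 0)
    (hb : Tendsto b atTop (𝓝 l)) :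
    Tendsto (fun n : ℕ => (n : ℝ) ^ 2 * exp ((n : ℝ) ^ γ * b n)) atTop (𝓝 0) := by
  have hN : Tendsto (fun n : ℕ => (n : ℝ) ^ γ) atTop atTop :=
    (tendsto_rpow_atTop hγ).comp tendsto_natCast_atTop_atTop
  have h := (tendsto_rpow_mul_exp_neg_mul_atTop_nhds_zero (2 / γ) (-l / 2) (by linarith)).comp hN
  refine squeeze_zero' (.of_forall fun n => by positivity) ?_ h
  filter_upwards [hb.eventually_lt_const (show l < l / 2 by linarith)] with n hn
  simp only [Function.comp_apply]
  rw [← Real.rpow_mul n.cast_nonneg, mul_div_cancel₀ _ hγ.ne', Real.rpow_two]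
  refine mul_le_mul_of_nonneg_left (Real.exp_le_exp.2 ?_) (by positivity)
  have := mul_le_mul_of_nonneg_left hn.le (show 0 ≤ (n : ℝ) ^ γ by positivity)
  linarith

lemma tendsto_exp_rpow_mul {γ : ℝ} (hγ : 0 < γ) {b : ℕ → ℝ} {l : ℝ} (hl : l < 0)
    (hb : Tendsto b atTop (𝓝 l)) :
    Tendsto (fun n : ℕ => exp ((n : ℝ) ^ γ * b n)) atTop (𝓝 0) := by
  refine squeeze_zero' (.of_forall fun n => (exp_pos _).le) ?_
    (tendsto_natCast_sq_mul_exp_rpow_mul hγ hl hb)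
  filter_upwards [eventually_ge_atTop 1] with n hn
  have : (1 : ℝ) ≤ n := by exact_mod_cast hn
  exact le_mul_of_one_le_left (exp_pos _).le (one_le_pow₀ this)

lemma tendsto_log_one_sub_mul_div (s : ℝ) {v : ℕ → ℝ} (hv : Tendsto v atTop (𝓝[>] 0)) :
    Tendsto (fun n => log (1 - s * v n) / v n) atTop (𝓝 (-s)) := by
  have h : HasDerivAt (fun u : ℝ => log (1 - s * u)) (-s) 0 := by
    have h1 : HasDerivAt (fun u : ℝ => 1 - s * u) (-s) 0 := by
      simpa using ((hasDerivAt_id (0 : ℝ)).const_mul s).const_sub 1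
    simpa using h1.log (by simp)
  have h2 := (hasDerivAt_iff_tendsto_slope.1 h).comp
    (hv.mono_right (nhdsWithin_mono _ fun x hx => (ne_of_gt hx : x ≠ 0)))
  refine h2.congr fun n => ?_
  simp [slope_def_field]

lemma add_one_lt_mul_add_rpow_neg {σ r : ℝ} (hσ : 0 < σ) (hr : 0 < r) (hr1 : r ≠ 1) :
    σ + 1 < σ * r + r ^ (-σ) := by
  have h1 := Real.add_one_le_exp (log r * -σ)
  rw [← Real.rpow_def_of_pos hr] at h1
  have h2 := Real.log_lt_sub_one_of_pos hr hr1
  nlinarith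

lemma sub_one_lt_mul_log {t : ℝ} (ht : 0 < t) (ht1 : t ≠ 1) : t - 1 < t * log t := by
  have h := Real.log_lt_sub_one_of_pos (inv_pos.2 ht) (by simpa using ht1)
  rw [Real.log_inv] at h
  have := mul_lt_mul_of_pos_left h ht
  rw [mul_sub, mul_inv_cancel₀ ht.ne'] at this
  linarith

section Scaling

variable {σ : ℝ}

lemma tendsto_natCast_rpow_neg_nhdsGT_zero (hσ : 0 < σ) :
    Tendsto (fun n : ℕ => (n : ℝ) ^ (-(1 / (1 + σ)))) atTop (𝓝[>] 0) := by
  refine tendsto_nhdsWithin_iff.2 ⟨(tendsto_rpow_neg_atTop (by positivity)).comp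
    tendsto_natCast_atTop_atTop, ?_⟩
  filter_upwards [eventually_ge_atTop 1] with n hn
  have : (0 : ℝ) < n := by exact_mod_cast hn
  exact Real.rpow_pos_of_pos this _

lemma natCast_mul_log_eq (hσ : 0 < σ) {n : ℕ} (hn : 1 ≤ n) (s : ℝ) :
    n * log (1 - s * (n : ℝ) ^ (-(1 / (1 + σ)))) = (n : ℝ) ^ (σ / (1 + σ)) *
      (log (1 - s * (n : ℝ) ^ (-(1 / (1 + σ)))) / (n : ℝ) ^ (-(1 / (1 + σ)))) := by
  have hn0 : (0 : ℝ) < n := by exact_mod_cast hn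
  have h : (n : ℝ) * (n : ℝ) ^ (-(1 / (1 + σ))) = (n : ℝ) ^ (σ / (1 + σ)) := by
    rw [← Real.rpow_one_add' hn0.le]
    · congr 1; field_simp; ring
    · have : 1 + -(1 / (1 + σ)) = σ / (1 + σ) := by field_simp; ring
      rw [this]; positivity
  have := (Real.rpow_pos_of_pos hn0 (-(1 / (1 + σ)))).ne'
  rw [← h]
  field_simp

lemma mul_rpow_neg_eq (hσ : 0 < σ) (n : ℕ) {s : ℝ} (hs : 0 < s) :
    (1 - (1 - s * (n : ℝ) ^ (-(1 / (1 + σ))))) ^ (-σ) = s ^ (-σ) * (n : ℝ) ^ (σ / (1 + σ)) := by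
  rw [sub_sub_cancel, Real.mul_rpow hs.le (by positivity), ← Real.rpow_mul n.cast_nonneg]
  congr 2
  field_simp

lemma eventually_one_sub_mem_Ioo (hσ : 0 < σ) {s : ℝ} (hs : 0 < s) :
    ∀ᶠ n : ℕ in atTop, 1 - s * (n : ℝ) ^ (-(1 / (1 + σ))) ∈ Set.Ioo 0 1 := by
  have hv := tendsto_natCast_rpow_neg_nhdsGT_zero hσ
  have h1 := (tendsto_nhdsWithin_iff.1 hv).1.eventually_lt_const (show 0 < 1 / s by positivity)
  filter_upwards [h1, (tendsto_nhdsWithin_iff.1 hv).2] with n hn hn0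
  rw [lt_div_iff₀ hs] at hn
  have : 0 < s * (n : ℝ) ^ (-(1 / (1 + σ))) := mul_pos hs hn0
  constructor <;> linarith

end Scaling

/-- The logarithmic decay rate of `1 - s * n ^ (-1 / (1 + σ))`, rescaled. -/
noncomputable def logRate (σ s : ℝ) (n : ℕ) : ℝ :=
  log (1 - s * (n : ℝ) ^ (-(1 / (1 + σ)))) / (n : ℝ) ^ (-(1 / (1 + σ)))

lemma tendsto_logRate {σ : ℝ} (hσ : 0 < σ) (s : ℝ) :
    Tendsto (logRate σ s) atTop (𝓝 (-s)) :=
  tendsto_log_one_sub_mul_div s (tendsto_natCast_rpow_neg_nhdsGT_zero hσ)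

lemma mul_rpow_neg_saddle {σ ζ : ℝ} (hσ : 0 < σ) (hζ : 0 < ζ) :
    ζ * ((σ * ζ) ^ ((1 : ℝ) / (1 + σ))) ^ (-σ) = (σ * ζ) ^ ((1 : ℝ) / (1 + σ)) / σ := by
  have h0 : 0 < σ * ζ := by positivity
  have h : (σ * ζ) ^ ((1 : ℝ) / (1 + σ)) =
      (σ * ζ) * ((σ * ζ) ^ ((1 : ℝ) / (1 + σ))) ^ (-σ) := by
    rw [← Real.rpow_mul h0.le, ← Real.rpow_one_add' h0.le]
    · congr 1; field_simp; ring
    · have : 1 + 1 / (1 + σ) * -σ = 1 / (1 + σ) := by field_simp; ring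
      rw [this]; positivity
  nth_rewrite 2 [h]
  field_simp

lemma eventually_blockWeight_le {σ z s : ℝ} (hσ : 0 < σ) (hz : 0 ≤ z) (hs : 0 < s) :
    ∀ᶠ n : ℕ in atTop,
      blockWeight σ z n ≤ exp ((n : ℝ) ^ (σ / (1 + σ)) * (z * s ^ (-σ) - logRate σ s n)) := by
  filter_upwards [eventually_one_sub_mem_Ioo hσ hs, eventually_ge_atTop 1] with n hn hn1
  refine (blockWeight_le hσ.le hz hn.1 hn.2 n).trans (Real.exp_le_exp.2 ?_)
  rw [natCast_mul_log_eq hσ hn1, mul_rpow_neg_eq hσ n hs, ← logRate]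
  linarith

lemma eventually_le_blockWeight_of_lt {σ ζ S c r : ℝ} (hσ : 0 < σ) (hζ : 0 < ζ) (hS : 0 < S)
    (hc : c = S / σ) (hSc : ζ * S ^ (-σ) = c) (hr : 1 < r) {a : ℝ} (ha : a = r ^ (-(2 * (1 + σ))))
    {l : ℝ} (hl : l < a * (S * r) + c * r ^ (-σ)) :
    ∀ᶠ n : ℕ in atTop, exp ((n : ℝ) ^ (σ / (1 + σ)) * l) ≤ blockWeight σ ζ n := by
  have hr0 : 0 < r := by linarith
  have hc0 : 0 < c := by rw [hc]; positivity
  have hγ : 0 < σ / (1 + σ) := by positivity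
  have ha0 : 0 < a := by rw [ha]; positivity
  have hS' : S = σ * c := by rw [hc]; field_simp
  have hpow : ∀ q, 0 < q → ζ * (S * q) ^ (-σ) = c * q ^ (-σ) := fun q hq => by
    rw [Real.mul_rpow hS.le hq.le, ← mul_assoc, hSc]
  have hneg1 : -(S * r) + S + c - c * r ^ (-σ) < 0 := by
    have := mul_lt_mul_of_pos_left (add_one_lt_mul_add_rpow_neg hσ hr0 hr.ne') hc0
    rw [hS']
    linarith
  have ha2 : (r * r) ^ (-σ) = a * r ^ 2 := by
    rw [ha, ← Real.rpow_two, ← Real.rpow_add hr0, ← sq, ← Real.rpow_two, ← Real.rpow_mul hr0.le]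
    congr 1; ring
  have hneg2 : a * (-(S * r) + S * (r * r)) + c * (r * r) ^ (-σ) - c * r ^ (-σ) < 0 := by
    have h := add_one_lt_mul_add_rpow_neg hσ (inv_pos.2 hr0) (by simpa using hr.ne')
    rw [Real.inv_rpow hr0.le, Real.rpow_neg hr0.le σ, inv_inv] at h
    have hrs : a * r ^ 2 * r ^ σ = r ^ (-σ) := by
      rw [← ha2, Real.mul_rpow hr0.le hr0.le, mul_assoc, ← Real.rpow_add hr0]
      simp
    have h3 := mul_lt_mul_of_pos_left h (show 0 < c * (a * r ^ 2) by positivity)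
    have e : c * (a * r ^ 2) * (σ * r⁻¹ + r ^ σ) = c * a * r * σ + c * r ^ (-σ) := by
      rw [← hrs]; field_simp
    rw [e] at h3
    rw [ha2, hS']
    linarith
  have hℓ := tendsto_logRate hσ
  have t1 := tendsto_exp_rpow_mul hγ hneg1
    (b := fun n => logRate σ (S * r) n - logRate σ S n + c - c * r ^ (-σ))
    (by simpa using (((hℓ (S * r)).sub (hℓ S)).add_const c).sub_const (c * r ^ (-σ)))
  have t2 := tendsto_exp_rpow_mul hγ hneg2
    (b := fun n => a * (logRate σ (S * r) n - logRate σ (S * (r * r)) n) +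
      c * (r * r) ^ (-σ) - c * r ^ (-σ))
    (by simpa using ((((hℓ (S * r)).sub (hℓ (S * (r * r)))).const_mul a).add_const
      (c * (r * r) ^ (-σ))).sub_const (c * r ^ (-σ)))
  have t3 := tendsto_natCast_sq_mul_exp_rpow_mul hγ
    (b := fun n => l + a * logRate σ (S * r) n - c * r ^ (-σ))
    (show l + a * -(S * r) - c * r ^ (-σ) < 0 by linarith)
    ((((hℓ (S * r)).const_mul a).const_add l).sub_const _)
  filter_upwards [eventually_one_sub_mem_Ioo hσ hS,
    eventually_one_sub_mem_Ioo hσ (show 0 < S * r by positivity),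
    eventually_one_sub_mem_Ioo hσ (show 0 < S * (r * r) by positivity),
    eventually_ge_atTop 1, t1.eventually_lt_const (show (0 : ℝ) < 1 / 4 by norm_num),
    t2.eventually_lt_const (show (0 : ℝ) < 1 / 4 by norm_num),
    t3.eventually_lt_const (show (0 : ℝ) < exp (-ζ) / 4 by positivity)] with n hy hx hz hn u1 u2 u3
  have hn1 : (1 : ℝ) ≤ n := by exact_mod_cast hn
  set N : ℝ := (n : ℝ) ^ (σ / (1 + σ)) with hN
  set v : ℝ := (n : ℝ) ^ (-(1 / (1 + σ))) with hv
  have hv0 : 0 < v := Real.rpow_pos_of_pos (by linarith) _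
  have hsum : ∀ q, 0 < q → 1 - S * q * v ∈ Set.Ioo 0 1 →
      HasSum (fun m : ℕ => blockWeight σ ζ m * exp (m * log (1 - S * q * v)))
        (exp (-ζ) * exp (N * (c * q ^ (-σ)))) := fun q hq hmem => by
    have h := hasSum_blockWeight hσ.le hζ.le hmem.1 hmem.2
    rw [hv, mul_rpow_neg_eq hσ n (mul_pos hS hq), ← hv, ← hN, mul_sub, ← mul_assoc,
      hpow q hq] at h
    rw [← Real.exp_add]
    convert h.congr_fun fun m => ?_ using 2
    · ring
    · rw [Real.exp_nat_mul, Real.exp_log hmem.1]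
  have hmonolog : ∀ q q', q ≤ q' → 0 < 1 - S * q' * v →
      log (1 - S * q' * v) ≤ log (1 - S * q * v) := fun q q' hqq hpos => by
    refine Real.log_le_log hpos ?_
    have : S * q * v ≤ S * q' * v := by gcongr
    linarith
  rw [← mul_one S] at hy
  have key := hasSum_le_of_monotone_mul (blockWeight_nonneg hσ.le hζ.le)
    (monotone_mul_blockWeight hσ.le hζ.le) (hmonolog r (r * r) (by nlinarith) hz.1)
    (hmonolog 1 r hr.le hx.1) (Real.log_nonpos hx.1.le hx.2.le) (hsum r hr0 hx)
    (hsum 1 one_pos hy) (hsum (r * r) (by positivity) hz) ha0 hn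
  have hlog : ∀ q, n * log (1 - S * q * v) = N * logRate σ (S * q) n := fun q =>
    natCast_mul_log_eq hσ hn _
  have e1 : exp (n * (log (1 - S * r * v) - log (1 - S * 1 * v))) *
      (exp (-ζ) * exp (N * (c * 1 ^ (-σ)))) = exp (-ζ) * exp (N * (c * r ^ (-σ))) *
      exp (N * (logRate σ (S * r) n - logRate σ S n + c - c * r ^ (-σ))) := by
    rw [mul_sub, hlog, hlog, ← Real.exp_add, ← Real.exp_add, ← Real.exp_add, ← Real.exp_add,
      Real.one_rpow, mul_one S]
    congr 1; ring
  have e2 : exp (a * n * (log (1 - S * r * v) - log (1 - S * (r * r) * v))) *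
      (exp (-ζ) * exp (N * (c * (r * r) ^ (-σ)))) = exp (-ζ) * exp (N * (c * r ^ (-σ))) *
      exp (N * (a * (logRate σ (S * r) n - logRate σ (S * (r * r)) n) +
      c * (r * r) ^ (-σ) - c * r ^ (-σ))) := by
    rw [mul_assoc, mul_sub, hlog, hlog, ← Real.exp_add, ← Real.exp_add, ← Real.exp_add,
      ← Real.exp_add]
    congr 1; ring
  rw [e1, e2, mul_assoc a, hlog] at key
  set F := exp (-ζ) * exp (N * (c * r ^ (-σ))) with hF
  have hF0 : 0 < F := by positivity
  have k1 := mul_lt_mul_of_pos_left u1 hF0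
  have k2 := mul_lt_mul_of_pos_left u2 hF0
  set A := blockWeight σ ζ n
  have hA : 0 ≤ A := blockWeight_nonneg hσ.le hζ.le n
  set E := exp (a * (N * logRate σ (S * r) n))
  have hE : 0 < E := exp_pos _
  have k3 : F / 4 ≤ n ^ 2 * A * E := by
    have : (n + 1) * (n * A * E) ≤ 2 * (n ^ 2 * A * E) := by
      have : 0 ≤ A * E := by positivity
      nlinarith
    linarith
  have k4 : n ^ 2 * exp (N * l) * E ≤ F / 4 := by
    have e : n ^ 2 * exp (N * (l + a * logRate σ (S * r) n - c * r ^ (-σ))) *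
        exp (N * (c * r ^ (-σ))) = n ^ 2 * exp (N * l) * E := by
      rw [mul_assoc, ← Real.exp_add, mul_assoc, ← Real.exp_add]
      congr 2; ring
    rw [← e, hF]
    have := mul_lt_mul_of_pos_right u3 (exp_pos (N * (c * r ^ (-σ))))
    linarith
  have hpos : 0 < (n : ℝ) ^ 2 * E := by positivity
  refine le_of_mul_le_mul_left ?_ hpos
  linarith

lemma eventually_le_blockWeight {σ ζ S c l : ℝ} (hσ : 0 < σ) (hζ : 0 < ζ) (hS : 0 < S)
    (hc : c = S / σ) (hSc : ζ * S ^ (-σ) = c) (hl : l < S + c) :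
    ∀ᶠ n : ℕ in atTop, exp ((n : ℝ) ^ (σ / (1 + σ)) * l) ≤ blockWeight σ ζ n := by
  have hcont : ContinuousAt
      (fun r : ℝ => r ^ (-(2 * (1 + σ))) * (S * r) + c * r ^ (-σ)) 1 := by
    refine ContinuousAt.add (ContinuousAt.mul ?_ (by fun_prop)) (continuousAt_const.mul ?_) <;>
    exact Real.continuousAt_rpow_const _ _ (.inl one_ne_zero)
  have hev : ∀ᶠ r in 𝓝[>] (1 : ℝ), l < r ^ (-(2 * (1 + σ))) * (S * r) + c * r ^ (-σ) :=
    (hcont.eventually_const_lt (by simpa using hl)).filter_mono nhdsWithin_le_nhds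
  obtain ⟨r, hlr, hr⟩ := (hev.and self_mem_nhdsWithin).exists
  exact eventually_le_blockWeight_of_lt hσ hζ hS hc hSc hr rfl hlr

lemma tendsto_tilted_blockWeight_div {σ ζ S c t : ℝ} (hσ : 0 < σ) (hζ : 0 < ζ) (hS : 0 < S)
    (hc : c = S / σ) (hSc : ζ * S ^ (-σ) = c) (ht : 0 < t) (ht1 : t ≠ 1) :
    Tendsto (fun n : ℕ => exp (-((n : ℝ) ^ (σ / (1 + σ)) * (c * t * log t))) *
      blockWeight σ (ζ * t) n / blockWeight σ ζ n) atTop (𝓝 0) := by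
  have hc0 : 0 < c := by rw [hc]; positivity
  have hγ : 0 < σ / (1 + σ) := by positivity
  have hgap := mul_lt_mul_of_pos_left (sub_one_lt_mul_log ht ht1) hc0
  set δ := (c * (t * log t) - c * (t - 1)) / 2 with hδ
  have h0 := tendsto_exp_rpow_mul hγ
    (b := fun n => c * t - c * t * log t - logRate σ S n - (S + c - δ))
    (show c * t - c * t * log t - -S - (S + c - δ) < 0 by linarith)
    (((tendsto_logRate hσ S).const_sub _).sub_const _)
  refine squeeze_zero' (.of_forall fun n => ?_) ?_ h0
  · exact div_nonneg (mul_nonneg (exp_pos _).le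
      (blockWeight_nonneg hσ.le (by positivity) n)) (blockWeight_nonneg hσ.le hζ.le n)
  · filter_upwards [eventually_blockWeight_le hσ (show 0 ≤ ζ * t by positivity) hS,
      eventually_le_blockWeight hσ hζ hS hc hSc (show S + c - δ < S + c by linarith)] with n hu hl
    rw [div_le_iff₀ ((exp_pos _).trans_le hl)]
    refine (mul_le_mul_of_nonneg_left hu (exp_pos _).le).trans
      (le_trans (le_of_eq ?_) (mul_le_mul_of_nonneg_left hl (exp_pos _).le))
    rw [← Real.exp_add, ← Real.exp_add, ← hSc]
    congr 1; ring

lemma sum_Icc_genFact_eq (σ z : ℝ) {n : ℕ} (hn : 1 ≤ n) :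
    ∑ k ∈ Finset.Icc 1 n, genFact n k (-σ) * (-z) ^ k = n.factorial * blockWeight σ z n := by
  obtain ⟨n, rfl⟩ := Nat.exists_eq_add_of_le' hn
  rw [blockWeight, mul_div_cancel₀ _ (by positivity), Finset.sum_range_succ',
    signlessGenFact_succ_zero, zero_mul, add_zero, Finset.range_eq_Ico,
    Finset.sum_Ico_add' (fun k => signlessGenFact σ (n + 1) k * z ^ k)]
  simp only [genFact_mul_neg_pow]
  rfl

/-- for `σ, ζ > 0`, under the NB-CPSM with `α = -σ`, `z = -ζ`, the number of blocks
rescaled by `n^{σ/(1+σ)}` converges in probability to the constant `(σζ)^{1/(1+σ)}/σ`. -/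
theorem nbcpsm_blocks_tendsto_const_neg
    (σ ζ : ℝ) (hσ : 0 < σ) (hζ : 0 < ζ) (ε : ℝ) (hε : 0 < ε) :
    Tendsto (fun n : ℕ =>
        (∑ k ∈ (Finset.Icc 1 n).filter (fun k : ℕ =>
            ε < |(k : ℝ) * (n : ℝ) ^ (-(σ / (1 + σ))) - (σ * ζ) ^ ((1 : ℝ) / (1 + σ)) / σ|),
          genFact n k (-σ) * (-ζ) ^ k) /
        (∑ j ∈ Finset.Icc 1 n, genFact n j (-σ) * (-ζ) ^ j))
      atTop (𝓝 0) := by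
  have hS : 0 < (σ * ζ) ^ ((1 : ℝ) / (1 + σ)) := by positivity
  have hSc := mul_rpow_neg_saddle hσ hζ
  set S := (σ * ζ) ^ ((1 : ℝ) / (1 + σ))
  set c := S / σ with hc
  have hc0 : 0 < c := by positivity
  obtain ⟨η, hη0, hη1, hηε⟩ : ∃ η : ℝ, 0 < η ∧ η < 1 ∧ c * η ≤ ε := by
    refine ⟨min (1 / 2) (ε / c), by positivity, (min_le_left _ _).trans_lt (by norm_num), ?_⟩
    rw [← le_div_iff₀' hc0]
    exact min_le_right _ _
  have hlim := (tendsto_tilted_blockWeight_div hσ hζ hS hc hSc (t := 1 + η) (by linarith)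
    (by linarith)).add (tendsto_tilted_blockWeight_div hσ hζ hS hc hSc (t := 1 - η) (by linarith)
    (by linarith))
  rw [add_zero] at hlim
  have hterm : ∀ n k : ℕ, 0 ≤ genFact n k (-σ) * (-ζ) ^ k := fun n k => by
    rw [genFact_mul_neg_pow]
    exact mul_nonneg (signlessGenFact_nonneg hσ.le n k) (by positivity)
  refine squeeze_zero' (.of_forall fun n => ?_) ?_ hlim
  · exact div_nonneg (Finset.sum_nonneg fun k _ => hterm n k)
      (Finset.sum_nonneg fun k _ => hterm n k)
  filter_upwards [eventually_ge_atTop 1] with n hn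
  have hn0 : (0 : ℝ) < n := by exact_mod_cast hn
  rw [← add_div, sum_Icc_genFact_eq σ ζ hn, ← mul_div_mul_left _ (blockWeight σ ζ n)
    (show (n.factorial : ℝ) ≠ 0 by positivity), mul_add, mul_left_comm,
    mul_left_comm (n.factorial : ℝ), ← sum_Icc_genFact_eq σ (ζ * (1 + η)) hn,
    ← sum_Icc_genFact_eq σ (ζ * (1 - η)) hn, Finset.mul_sum, Finset.mul_sum,
    ← Finset.sum_add_distrib]
  refine div_le_div_of_nonneg_right ?_
    (mul_nonneg (by positivity) (blockWeight_nonneg hσ.le hζ.le n))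
  set N : ℝ := (n : ℝ) ^ (σ / (1 + σ)) with hN
  have hN0 : 0 < N := Real.rpow_pos_of_pos hn0 _
  have hsplit : ∀ (t : ℝ) (k : ℕ), 0 < t →
      exp (-(N * (c * t * log t))) * (genFact n k (-σ) * (-(ζ * t)) ^ k) =
      genFact n k (-σ) * (-ζ) ^ k * exp ((k - N * (c * t)) * log t) := fun t k ht => by
    rw [neg_mul_eq_neg_mul ζ t, mul_pow, sub_mul, sub_eq_add_neg, Real.exp_add, Real.exp_nat_mul,
      Real.exp_log ht, mul_assoc N]
    ring
  have hsplit0 : ∀ (t : ℝ) (k : ℕ), 0 < t →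
      0 ≤ exp (-(N * (c * t * log t))) * (genFact n k (-σ) * (-(ζ * t)) ^ k) := fun t k ht => by
    rw [hsplit t k ht]
    exact mul_nonneg (hterm n k) (exp_pos _).le
  refine le_trans (Finset.sum_le_sum fun k hk => ?_)
    (Finset.sum_le_sum_of_subset_of_nonneg (Finset.filter_subset _ _) fun k _ _ =>
      add_nonneg (hsplit0 _ k (by linarith)) (hsplit0 _ k (by linarith)))
  have hk := (Finset.mem_filter.1 hk).2
  rw [Real.rpow_neg hn0.le, ← hN, ← div_eq_mul_inv] at hk
  rcases lt_abs.1 hk with h | h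
  · have hkN : N * (c * (1 + η)) ≤ k := by
      have : c * (1 + η) ≤ k / N := by linarith
      rwa [le_div_iff₀ hN0, mul_comm] at this
    refine le_add_of_le_of_nonneg ?_ (hsplit0 _ k (by linarith))
    rw [hsplit _ _ (by linarith)]
    exact le_mul_of_one_le_right (hterm n k) (Real.one_le_exp
      (mul_nonneg (by linarith) (Real.log_nonneg (by linarith))))
  · have hkN : k ≤ N * (c * (1 - η)) := by
      have : k / N ≤ c * (1 - η) := by linarith
      rwa [div_le_iff₀ hN0, mul_comm] at this
    refine le_add_of_nonneg_of_le (hsplit0 _ k (by linarith)) ?_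
    rw [hsplit _ _ (by linarith)]
    exact le_mul_of_one_le_right (hterm n k) (Real.one_le_exp
      (mul_nonneg_of_nonpos_of_nonpos (by linarith) (Real.log_nonpos (by linarith) (by linarith))))
end

section
/- For every real α, every real z > 0 and every integer n ≥ 1, the following identity holds: ∑_{j=1}^n 𝒞(n,j;α) z^j = ∑_{i=1}^n (-1)^i (-iα)_{(n)} e^z z^i Γ(n-i+1, z) / (i! Γ(n-i+1)), where Γ(a,x) := ∫_x^∞ t^{a-1} e^{-t} dt is the upper incomplete gamma function and Γ(a) is the gamma function. -/
open Finset Filter Real MeasureTheory Topology Set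

/-- Upper incomplete gamma function `Γ(a,x) = ∫_x^∞ t^{a-1} e^{-t} dt`. -/
noncomputable def upperIncGamma (a x : ℝ) : ℝ :=
  ∫ t in Set.Ioi x, t ^ (a - 1) * Real.exp (-t)

theorem hasDerivAt_neg_exp_neg_mul_sum_pow_div_factorial (m : ℕ) (t : ℝ) :
    HasDerivAt
      (fun t : ℝ => -Real.exp (-t) * ∑ k ∈ Finset.range (m + 1), t ^ k / (Nat.factorial k : ℝ))
      (t ^ m * Real.exp (-t) / (Nat.factorial m : ℝ)) t := by
  have hexp : HasDerivAt (fun t : ℝ => -Real.exp (-t)) (Real.exp (-t)) t := by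
    exact (hasDerivAt_neg t).exp.neg.congr_deriv (by simp)
  induction m with
  | zero => simpa using hexp
  | succ m ih =>
    have hpow : HasDerivAt (fun t : ℝ => t ^ (m + 1) / (Nat.factorial (m + 1) : ℝ))
        (t ^ m / (Nat.factorial m : ℝ)) t := by
      refine ((hasDerivAt_pow (m + 1) t).div_const _).congr_deriv ?_
      have := Nat.factorial_ne_zero m
      rw [Nat.factorial_succ]
      push_cast
      field_simp
    simp_rw [Finset.sum_range_succ _ (m + 1), mul_add]
    refine (ih.add (hexp.mul hpow)).congr_deriv ?_
    ring

theorem tendsto_neg_exp_neg_mul_sum_pow_div_factorial (m : ℕ) :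
    Tendsto
      (fun t : ℝ => -Real.exp (-t) * ∑ k ∈ Finset.range m, t ^ k / (Nat.factorial k : ℝ))
      atTop (𝓝 0) := by
  have h : Tendsto (fun t : ℝ => ∑ k ∈ Finset.range m,
      -(t ^ k * Real.exp (-t) / (Nat.factorial k : ℝ))) atTop
      (𝓝 (∑ k ∈ Finset.range m, -(0 / (Nat.factorial k : ℝ)))) :=
    tendsto_finsetSum _ fun k _ =>
      ((Real.tendsto_pow_mul_exp_neg_atTop_nhds_zero k).div_const _).neg
  simp only [zero_div, neg_zero, Finset.sum_const_zero] at h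
  refine h.congr fun t => ?_
  rw [Finset.mul_sum]
  exact Finset.sum_congr rfl fun k _ => by ring

theorem upperIncGamma_natCast_add_one (m : ℕ) {z : ℝ} (hz : 0 ≤ z) :
    upperIncGamma ((m : ℝ) + 1) z =
      (Nat.factorial m : ℝ) * Real.exp (-z) *
        ∑ k ∈ Finset.range (m + 1), z ^ k / (Nat.factorial k : ℝ) := by
  have hm : (Nat.factorial m : ℝ) ≠ 0 := Nat.cast_ne_zero.mpr (Nat.factorial_ne_zero m)
  have h := integral_Ioi_of_hasDerivAt_of_nonneg' (a := z)
    (fun t _ => hasDerivAt_neg_exp_neg_mul_sum_pow_div_factorial m t)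
    (fun t ht => by
      have : 0 ≤ t := hz.trans (le_of_lt ht)
      positivity)
    (tendsto_neg_exp_neg_mul_sum_pow_div_factorial (m + 1))
  rw [integral_div, div_eq_iff hm] at h
  simp only [upperIncGamma, add_sub_cancel_right, Real.rpow_natCast]
  rw [h]
  ring

theorem ascFact_zero_left {n : ℕ} (hn : 1 ≤ n) : ascFact 0 n = 0 :=
  Finset.prod_eq_zero (Finset.mem_range.mpr hn) (by simp)

theorem genFact_zero_right {n : ℕ} (hn : 1 ≤ n) (α : ℝ) : genFact n 0 α = 0 := by
  simp [genFact, ascFact_zero_left hn]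

theorem genFact_mul_pow (n j : ℕ) (α z : ℝ) :
    genFact n j α * z ^ j = ∑ i ∈ Finset.range (j + 1),
      (-1) ^ i * ascFact (-(i * α)) n * z ^ i / (Nat.factorial i : ℝ) *
        (z ^ (j - i) / (Nat.factorial (j - i) : ℝ)) := by
  rw [genFact, Finset.mul_sum, Finset.sum_mul]
  refine Finset.sum_congr rfl fun i hi => ?_
  have hij : i ≤ j := Nat.lt_succ_iff.mp (Finset.mem_range.mp hi)
  have := Nat.factorial_ne_zero j
  have := Nat.factorial_ne_zero i
  have := Nat.factorial_ne_zero (j - i)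
  rw [Nat.cast_choose ℝ hij, ← pow_mul_pow_sub z hij]
  field_simp

theorem sum_Icc_one_eq_sum_range_succ {f : ℕ → ℝ} (h0 : f 0 = 0) (n : ℕ) :
    ∑ j ∈ Finset.Icc 1 n, f j = ∑ j ∈ Finset.range (n + 1), f j := by
  refine Finset.sum_subset (fun j hj => ?_) fun j hj hj' => ?_
  · simp only [Finset.mem_Icc, Finset.mem_range] at *
    omega
  · simp only [Finset.mem_Icc, Finset.mem_range] at *
    obtain rfl : j = 0 := by omega
    exact h0

/-- for every real `α`, `z > 0` and `n ≥ 1`,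
`∑_{j=1}^n 𝒞(n,j;α) z^j = ∑_{i=1}^n (-1)^i (-iα)_{(n)} e^z z^i Γ(n-i+1,z)/(i! Γ(n-i+1))`. -/
theorem genFact_sum_eq_incGamma_sum
    (α z : ℝ) (hz : 0 < z) (n : ℕ) (hn : 1 ≤ n) :
    ∑ j ∈ Finset.Icc 1 n, genFact n j α * z ^ j =
    ∑ i ∈ Finset.Icc 1 n,
      (-1 : ℝ) ^ i * ascFact (-(i * α)) n * Real.exp z * z ^ i *
        upperIncGamma ((n : ℝ) - i + 1) z /
        ((Nat.factorial i : ℝ) * Real.Gamma ((n : ℝ) - i + 1)) := by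
  rw [sum_Icc_one_eq_sum_range_succ (by simp [genFact_zero_right hn]),
    sum_Icc_one_eq_sum_range_succ (by simp [ascFact_zero_left hn])]
  simp_rw [genFact_mul_pow]
  rw [Finset.sum_range_diag_flip (n + 1) fun i k =>
    (-1) ^ i * ascFact (-(i * α)) n * z ^ i / (Nat.factorial i : ℝ) *
      (z ^ k / (Nat.factorial k : ℝ))]
  refine Finset.sum_congr rfl fun i hi => ?_
  have hin : i ≤ n := Nat.lt_succ_iff.mp (Finset.mem_range.mp hi)
  have := Nat.factorial_ne_zero i
  have := Nat.factorial_ne_zero (n - i)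
  rw [← Finset.mul_sum, ← Nat.cast_sub hin, upperIncGamma_natCast_add_one _ hz.le,
    Real.Gamma_nat_eq_factorial, Nat.sub_add_comm hin, Real.exp_neg]
  field_simp
end

section
/- Let α ∈ (0,1). For every integer n with n > 1/(1-α) and every integer i with 2 ≤ i ≤ n such that iα is not an integer, the following bound holds: (1/i!) · |(-iα)_{(n)} / (-α)_{(n)}| ≤ (|Γ(-α)| / π) · (Γ(n-2α) / Γ(n-α)) · (Γ(iα+1) / i!). -/
open Finset Filter Real MeasureTheory Topology Set

theorem ascFact_mul_Gamma (x : ℝ) (hx : ∀ m : ℕ, x ≠ -m) (n : ℕ) :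
    ascFact x n * Real.Gamma x = Real.Gamma (x + n) := by
  induction n with
  | zero => simp [ascFact]
  | succ n ih =>
    have h : x + n ≠ 0 := fun h => hx n (by linarith)
    have hs : ascFact x (n + 1) = ascFact x n * (x + n) := Finset.prod_range_succ _ _
    rw [hs, mul_right_comm, ih, Nat.cast_succ, ← add_assoc, Real.Gamma_add_one h, mul_comm]

theorem ascFact_eq_Gamma_div (x : ℝ) (hx : ∀ m : ℕ, x ≠ -m) (n : ℕ) :
    ascFact x n = Real.Gamma (x + n) / Real.Gamma x :=
  eq_div_of_mul_eq (Real.Gamma_ne_zero hx) (ascFact_mul_Gamma x hx n)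

/-- Absolute-value form of the reflection formula, for the reciprocal of `Γ(-x)`. -/
theorem abs_inv_Gamma_neg (x : ℝ) (hx : 0 < x) :
    |(Real.Gamma (-x))⁻¹| = Real.Gamma (x + 1) * |Real.sin (π * x)| / π := by
  have hG : 0 < Real.Gamma (x + 1) := Real.Gamma_pos_of_pos (by linarith)
  have h := Real.Gamma_mul_Gamma_one_sub (-x)
  rw [show 1 - -x = x + 1 by ring, mul_neg, Real.sin_neg] at h
  have h' : Real.Gamma (-x) = π / -Real.sin (π * x) / Real.Gamma (x + 1) :=
    eq_div_of_mul_eq hG.ne' h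
  rw [h', inv_div, abs_div, abs_div, abs_neg, abs_of_pos hG, abs_of_pos Real.pi_pos]
  simp [div_eq_mul_inv, mul_assoc]

theorem Gamma_le_one_of_mem_Icc {y : ℝ} (h1 : 1 ≤ y) (h2 : y ≤ 2) : Real.Gamma y ≤ 1 := by
  have h := Real.convexOn_Gamma.2 (show (1 : ℝ) ∈ Set.Ioi 0 by simp) (show (2 : ℝ) ∈ Set.Ioi 0 by simp)
    (show 0 ≤ 2 - y by linarith) (show 0 ≤ y - 1 by linarith) (by ring)
  simp only [smul_eq_mul, Real.Gamma_one, Real.Gamma_two] at h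
  rw [show (2 - y) * 1 + (y - 1) * 2 = y by ring] at h
  linarith

theorem Gamma_le_Gamma_of_two_le {y z : ℝ} (hy : 1 ≤ y) (hz : 2 ≤ z) (hyz : y ≤ z) :
    Real.Gamma y ≤ Real.Gamma z := by
  have hmono := Real.Gamma_strictMonoOn_Ici.monotoneOn
  rcases le_total 2 y with h | h
  · exact hmono h hz hyz
  · calc Real.Gamma y ≤ 1 := Gamma_le_one_of_mem_Icc hy h
      _ = Real.Gamma 2 := Real.Gamma_two.symm
      _ ≤ Real.Gamma z := hmono Set.self_mem_Ici hz hz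

theorem sub_one_le_Gamma {z : ℝ} (h0 : 0 < z) (h2 : z ≤ 2) : z - 1 ≤ Real.Gamma z := by
  have hd : 0 < 3 - z := by linarith
  have h := Real.convexOn_Gamma.2 h0 (show (3 : ℝ) ∈ Set.Ioi 0 by simp)
    (show 0 ≤ 1 / (3 - z) by positivity)
    (show 0 ≤ (2 - z) / (3 - z) from div_nonneg (by linarith) hd.le) (by field_simp; ring)
  have h3 : Real.Gamma 3 = 2 := by
    rw [show (3 : ℝ) = 2 + 1 by norm_num, Real.Gamma_add_one two_ne_zero, Real.Gamma_two, mul_one]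
  simp only [smul_eq_mul, h3] at h
  rw [show 1 / (3 - z) * z + (2 - z) / (3 - z) * 3 = 2 by field_simp; ring, Real.Gamma_two,
    show 1 / (3 - z) * Real.Gamma z + (2 - z) / (3 - z) * 2 =
      (Real.Gamma z + (2 - z) * 2) / (3 - z) by ring, le_div_iff₀ hd] at h
  linarith

theorem Gamma_three_half_le : Real.Gamma (3 / 2) ≤ 0.8863 := by
  rw [show (3 / 2 : ℝ) = 1 / 2 + 1 by norm_num, Real.Gamma_add_one (by norm_num),
    Real.Gamma_one_half_eq]
  have : √π ≤ 1.7726 := Real.sqrt_le_iff.2 ⟨by norm_num, by linarith [Real.pi_lt_d4]⟩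
  linarith

/-- The chord bound for the convex function `Γ` on `[1, 3/2]`. -/
theorem Gamma_three_half_sub_le {d : ℝ} (h0 : 0 ≤ d) (h1 : d ≤ 1 / 3) :
    Real.Gamma (3 / 2 - 3 / 2 * d) ≤ 0.8863 + 0.3411 * d := by
  have h := Real.convexOn_Gamma.2 (show (1 : ℝ) ∈ Set.Ioi 0 by simp)
    (show (3 / 2 : ℝ) ∈ Set.Ioi 0 by norm_num)
    (show 0 ≤ 3 * d by linarith) (show 0 ≤ 1 - 3 * d by linarith) (by ring)
  simp only [smul_eq_mul, Real.Gamma_one] at h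
  rw [show 3 * d * 1 + (1 - 3 * d) * (3 / 2) = 3 / 2 - 3 / 2 * d by ring] at h
  have := mul_le_mul_of_nonneg_left Gamma_three_half_le (show 0 ≤ 1 - 3 * d by linarith)
  linarith

theorem Gamma_three_sub_mul_abs_sin_le {a : ℝ} (h1 : 1 / 2 ≤ a) (h2 : a ≤ 2 / 3) :
    Real.Gamma (3 - 3 * a) * |Real.sin (π * (3 * a))| ≤ Real.Gamma (3 - 2 * a) := by
  obtain ⟨d, rfl⟩ : ∃ d, a = (1 + d) / 2 := ⟨2 * a - 1, by ring⟩
  have hd0 : 0 ≤ d := by linarith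
  have hd1 : d ≤ 1 / 3 := by linarith
  have hπ := Real.pi_pos
  have hsin : |Real.sin (π * (3 * ((1 + d) / 2)))| = Real.cos (3 * π / 2 * d) := by
    rw [show π * (3 * ((1 + d) / 2)) = (3 * π / 2 * d + π / 2) + π by ring, Real.sin_add_pi,
      Real.sin_add_pi_div_two, abs_neg, abs_of_nonneg]
    exact Real.cos_nonneg_of_mem_Icc ⟨by nlinarith, by nlinarith⟩
  have hcos : Real.cos (3 * π / 2 * d) ≤ 1 - 4.5 * d ^ 2 := by
    have h := Real.cos_le_one_sub_mul_cos_sq (x := 3 * π / 2 * d)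
      (by rw [abs_of_nonneg (by positivity)]; nlinarith)
    calc _ ≤ _ := h
      _ = _ := by field_simp; ring
  have hΓ := Gamma_three_half_sub_le hd0 hd1
  have hz := sub_one_le_Gamma (z := 2 - d) (by linarith) (by linarith)
  rw [hsin, show 3 - 3 * ((1 + d) / 2) = 3 / 2 - 3 / 2 * d by ring,
    show 3 - 2 * ((1 + d) / 2) = 2 - d by ring]
  have hG0 : 0 < Real.Gamma (3 / 2 - 3 / 2 * d) := Real.Gamma_pos_of_pos (by linarith)
  have hq : 0 ≤ 1 - 4.5 * d ^ 2 := by nlinarith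
  calc _ ≤ Real.Gamma (3 / 2 - 3 / 2 * d) * (1 - 4.5 * d ^ 2) :=
        mul_le_mul_of_nonneg_left hcos hG0.le
    _ ≤ (0.8863 + 0.3411 * d) * (1 - 4.5 * d ^ 2) := mul_le_mul_of_nonneg_right hΓ hq
    _ ≤ 2 - d - 1 := by nlinarith [sq_nonneg (d - 0.168), pow_nonneg hd0 3]
    _ ≤ _ := hz

theorem Gamma_sub_mul_abs_sin_le {α : ℝ} (hα : α ∈ Set.Ioo (0 : ℝ) 1) {n i : ℕ}
    (hn : 1 / (1 - α) < (n : ℝ)) (hi2 : 2 ≤ i) (hin : i ≤ n) :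
    Real.Gamma (n - i * α) * |Real.sin (π * (i * α))| ≤ Real.Gamma (n - 2 * α) := by
  obtain ⟨h0, h1⟩ := hα
  rw [div_lt_iff₀ (by linarith)] at hn
  have hi2' : (2 : ℝ) ≤ i := by exact_mod_cast hi2
  have hin' : (i : ℝ) ≤ n := by exact_mod_cast hin
  have hy : 1 ≤ n - i * α := by nlinarith
  have hyz : n - i * α ≤ n - 2 * α := by nlinarith
  have hG := (Real.Gamma_pos_of_pos (show 0 < n - i * α by linarith)).le
  have hle : Real.Gamma (n - i * α) * |Real.sin (π * (i * α))| ≤ Real.Gamma (n - i * α) :=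
    mul_le_of_le_one_right hG (Real.abs_sin_le_one _)
  rcases le_or_gt 2 (n - 2 * α) with hz | hz
  · exact hle.trans (Gamma_le_Gamma_of_two_le hy hz hyz)
  have hn4 : n < 4 := by
    have : (n : ℝ) < 4 := by linarith
    exact_mod_cast this
  obtain rfl | rfl : i = 2 ∨ i = 3 := by omega
  · exact_mod_cast hle
  · obtain rfl : n = 3 := by omega
    push_cast at *
    exact Gamma_three_sub_mul_abs_sin_le (by linarith) (by linarith)

/-- for `α ∈ (0,1)`, `n > 1/(1-α)` and `2 ≤ i ≤ n` with `iα` not an integer,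
`(1/i!) |(-iα)_{(n)}/(-α)_{(n)}| ≤ (|Γ(-α)|/π) (Γ(n-2α)/Γ(n-α)) (Γ(iα+1)/i!)`. -/
theorem ascFact_ratio_bound
    (α : ℝ) (hα : α ∈ Set.Ioo (0 : ℝ) 1) (n i : ℕ)
    (hn : 1 / (1 - α) < (n : ℝ)) (hi2 : 2 ≤ i) (hin : i ≤ n)
    (hnotint : ∀ m : ℤ, (i : ℝ) * α ≠ (m : ℝ)) :
    (1 / (Nat.factorial i : ℝ)) * |ascFact (-(i * α)) n / ascFact (-α) n| ≤
      (|Real.Gamma (-α)| / π) * (Real.Gamma ((n : ℝ) - 2 * α) / Real.Gamma ((n : ℝ) - α)) *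
        (Real.Gamma ((i : ℝ) * α + 1) / (Nat.factorial i : ℝ)) := by
  obtain ⟨h0, h1⟩ := hα
  have hi2' : (2 : ℝ) ≤ i := by exact_mod_cast hi2
  have hn2 : (2 : ℝ) ≤ n := by exact_mod_cast hi2.trans hin
  have hin' : (i : ℝ) ≤ n := by exact_mod_cast hin
  have hx1 : ∀ m : ℕ, -(i * α) ≠ -(m : ℝ) := fun m h => hnotint m (by push_cast; linarith)
  have hx2 : ∀ m : ℕ, -α ≠ -(m : ℝ) := by
    intro m h
    have hm0 : (0 : ℝ) < m := by linarith
    have hm1 : (m : ℝ) < 1 := by linarith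
    norm_cast at hm0 hm1
    omega
  have hGi : 0 < Real.Gamma (n - i * α) := Real.Gamma_pos_of_pos (by nlinarith)
  have hGn : 0 < Real.Gamma (n - α) := Real.Gamma_pos_of_pos (by linarith)
  have hG1 : 0 < Real.Gamma (i * α + 1) := Real.Gamma_pos_of_pos (by positivity)
  have key := Gamma_sub_mul_abs_sin_le ⟨h0, h1⟩ hn hi2 hin
  have habs : |ascFact (-(i * α)) n / ascFact (-α) n| =
      |Real.Gamma (-α)| / π * ((Real.Gamma (n - i * α) * |Real.sin (π * (i * α))|) /
        Real.Gamma (n - α)) * Real.Gamma (i * α + 1) := by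
    rw [ascFact_eq_Gamma_div _ hx1, ascFact_eq_Gamma_div _ hx2, neg_add_eq_sub, neg_add_eq_sub,
      div_eq_mul_inv (Real.Gamma (n - i * α)), abs_div, abs_mul, abs_div,
      abs_inv_Gamma_neg _ (by positivity), abs_of_pos hGi, abs_of_pos hGn, div_div_eq_mul_div]
    ring
  rw [habs, one_div_mul_eq_div, mul_div_assoc]
  have hπ := Real.pi_pos
  gcongr
end

section
/- Let α ∈ (0,1) and t > 0. Then the integral ∫_0^∞ e^{t z^α - z} dz is finite, and ∑_{i=0}^∞ t^i Γ(iα + 1) / i! = ∫_0^∞ e^{t z^α - z} dz; in particular the series ∑_{i≥0} t^i Γ(iα+1)/i! converges. -/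
open Finset Filter Real MeasureTheory Topology Set

/-- A sublinear power in the exponent is absorbed by half of the linear term. -/
lemma integrableOn_exp_mul_rpow_sub {α : ℝ} (hα : α ∈ Set.Ioo (0 : ℝ) 1) (t : ℝ) :
    IntegrableOn (fun z : ℝ => Real.exp (t * z ^ α - z)) (Set.Ioi 0) := by
  refine integrable_of_isBigO_exp_neg (b := 1 / 2) (by norm_num) ?_ ?_
  · have hc : Continuous (fun z : ℝ => z ^ α) := Real.continuous_rpow_const hα.1.le
    exact Continuous.continuousOn (by fun_prop)
  · have ho : (fun z : ℝ => t * z ^ α) =o[atTop] fun z : ℝ => z := by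
      refine Asymptotics.IsLittleO.const_mul_left (Asymptotics.isLittleO_of_tendsto' ?_ ?_) t
      · filter_upwards [eventually_gt_atTop 0] with z hz h0 using absurd h0 hz.ne'
      · refine (tendsto_rpow_neg_atTop (sub_pos.2 hα.2)).congr' ?_
        filter_upwards [eventually_gt_atTop 0] with z hz
        rw [neg_sub, Real.rpow_sub_one hz.ne']
    refine Asymptotics.IsBigO.of_bound 1 ?_
    filter_upwards [ho.bound (show (0 : ℝ) < 1 / 2 by norm_num), eventually_ge_atTop 0]
      with z hz hz0
    rw [one_mul, Real.norm_of_nonneg (Real.exp_nonneg _), Real.norm_of_nonneg (Real.exp_nonneg _)]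
    rw [Real.norm_of_nonneg hz0] at hz
    refine Real.exp_le_exp.2 ?_
    linarith [Real.le_norm_self (t * z ^ α)]

/-- The integral of one term of the exponential series of `t * z ^ α`, against `exp (-z)`. -/
lemma integral_exp_series_term {α : ℝ} (hα : 0 < α) (t : ℝ) (i : ℕ) :
    ∫ z in Set.Ioi (0 : ℝ), (t * z ^ α) ^ i / (Nat.factorial i : ℝ) * Real.exp (-z) =
      t ^ i * Real.Gamma ((i : ℝ) * α + 1) / (Nat.factorial i : ℝ) := by
  rw [Real.Gamma_eq_integral (by positivity), mul_div_right_comm, ← integral_const_mul]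
  refine setIntegral_congr_fun measurableSet_Ioi fun z hz => ?_
  have hz' : (0 : ℝ) ≤ z := (Set.mem_Ioi.1 hz).le
  simp only [add_sub_cancel_right]
  rw [mul_pow, mul_comm (i : ℝ) α, Real.rpow_mul hz', Real.rpow_natCast]
  ring

/-- for `α ∈ (0,1)` and `t > 0`, the integral `∫_0^∞ e^{t z^α - z} dz` is finite,
the series `∑_{i≥0} t^i Γ(iα+1)/i!` converges, and the two are equal. -/
theorem tsum_gamma_eq_integral
    (α t : ℝ) (hα : α ∈ Set.Ioo (0 : ℝ) 1) (ht : 0 < t) :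
    IntegrableOn (fun z : ℝ => Real.exp (t * z ^ α - z)) (Set.Ioi 0) ∧
    Summable (fun i : ℕ => t ^ i * Real.Gamma ((i : ℝ) * α + 1) / (Nat.factorial i : ℝ)) ∧
    ∑' i : ℕ, t ^ i * Real.Gamma ((i : ℝ) * α + 1) / (Nat.factorial i : ℝ) =
      ∫ z in Set.Ioi (0 : ℝ), Real.exp (t * z ^ α - z) := by
  have hint := integrableOn_exp_mul_rpow_sub hα t
  have hser : ∀ z : ℝ, HasSum
      (fun i : ℕ => (t * z ^ α) ^ i / (Nat.factorial i : ℝ) * Real.exp (-z))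
      (Real.exp (t * z ^ α - z)) := fun z => by
    rw [sub_eq_add_neg, Real.exp_add, Real.exp_eq_exp_ℝ]
    exact (NormedSpace.expSeries_div_hasSum_exp (t * z ^ α)).mul_right _
  have hsum := hasSum_integral_of_dominated_convergence
    (μ := volume.restrict (Set.Ioi (0 : ℝ)))
    (F := fun (i : ℕ) (z : ℝ) => (t * z ^ α) ^ i / (Nat.factorial i : ℝ) * Real.exp (-z))
    (fun (i : ℕ) (z : ℝ) => (t * z ^ α) ^ i / (Nat.factorial i : ℝ) * Real.exp (-z))
    (fun i => Measurable.aestronglyMeasurable (by fun_prop))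
    (fun i => by
      filter_upwards [ae_restrict_mem measurableSet_Ioi] with z hz
      have hz' : (0 : ℝ) < z := hz
      exact (Real.norm_of_nonneg (by positivity)).le)
    (ae_of_all _ fun z => (hser z).summable)
    (by simpa only [fun z => (hser z).tsum_eq, IntegrableOn] using hint)
    (ae_of_all _ hser)
  simp only [integral_exp_series_term hα.1] at hsum
  exact ⟨hint, hsum.summable, hsum.tsum_eq⟩
end

section
/- Let σ > 0, w > 0 and let n ≥ 1 be an integer. Then ∑_{j=1}^{∞} e^{-w} (w^j / j!) · Γ(σ j + n) / Γ(σ j) = ∫_0^∞ t^{n-1} e^{-(w+t)} W_{σ,0}(w t^{σ}) dt, where W_{σ,0}(y) := ∑_{j=1}^{∞} y^j / (j! Γ(jσ)) is the Wright function with second index 0. -/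
open Finset Filter Real MeasureTheory Topology Set

/-- The Wright function with indices `σ` and `τ = 0`: `W_{σ,0}(y) = ∑_{j≥1} y^j/(j! Γ(jσ))`.
(The `j = 0` term vanishes since `Γ(0) = 0` in Mathlib's convention.) -/
noncomputable def wrightZero (σ y : ℝ) : ℝ :=
  ∑' j : ℕ, y ^ j / ((Nat.factorial j : ℝ) * Real.Gamma ((j : ℝ) * σ))

/-- For `s ≥ 0`, the quotient `Γ(s+n)/Γ(s)` is at most `(s+n)^n`. -/
theorem Gamma_add_nat_div_Gamma_le_pow {s : ℝ} (hs : 0 ≤ s) (n : ℕ) :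
    Real.Gamma (s + n) / Real.Gamma s ≤ (s + n) ^ n := by
  rcases hs.eq_or_lt with rfl | hs
  · rw [Real.Gamma_zero, div_zero]
    positivity
  induction n with
  | zero => simp [(Real.Gamma_pos_of_pos hs).ne']
  | succ n ih =>
    have hn : 0 < s + n := by positivity
    have hle : s + (n : ℝ) ≤ s + (n + 1 : ℕ) := by
      push_cast
      linarith
    calc Real.Gamma (s + (n + 1 : ℕ)) / Real.Gamma s
        = (s + n) * (Real.Gamma (s + n) / Real.Gamma s) := by
          rw [Nat.cast_succ, ← add_assoc, Real.Gamma_add_one hn.ne', mul_div_assoc]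
      _ ≤ (s + n) * (s + n) ^ n := by gcongr
      _ = (s + n) ^ (n + 1) := (pow_succ' _ _).symm
      _ ≤ (s + (n + 1 : ℕ)) ^ (n + 1) := by gcongr

/-- The Poisson average of `Γ(σj+n)/Γ(σj)` converges. -/
theorem summable_poisson_mul_Gamma_div_Gamma {σ w : ℝ} (hσ : 0 < σ) (hw : 0 < w) (n : ℕ) :
    Summable fun j : ℕ ↦ Real.exp (-w) * (w ^ j / (Nat.factorial j : ℝ)) *
      (Real.Gamma (σ * j + n) / Real.Gamma (σ * j)) := by
  have hsum := (Real.summable_pow_div_factorial (w * Real.exp σ)).mul_left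
    (Real.exp (-w) * (Nat.factorial n * Real.exp n))
  refine hsum.of_nonneg_of_le (fun j ↦ ?_) (fun j ↦ ?_)
  · have h₁ : 0 ≤ Real.Gamma (σ * j + n) := Real.Gamma_nonneg_of_nonneg (by positivity)
    have h₂ : 0 ≤ Real.Gamma (σ * j) := Real.Gamma_nonneg_of_nonneg (by positivity)
    positivity
  · have hs : 0 ≤ σ * j := by positivity
    have hexp : (σ * j + n) ^ n ≤ Nat.factorial n * Real.exp (σ * j + n) := by
      have := Real.pow_div_factorial_le_exp (σ * j + n) (by positivity) n
      rwa [div_le_iff₀' (by positivity)] at this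
    calc _ ≤ Real.exp (-w) * (w ^ j / (Nat.factorial j : ℝ)) *
          (Nat.factorial n * Real.exp (σ * j + n)) := by
            gcongr
            exact (Gamma_add_nat_div_Gamma_le_pow hs n).trans hexp
      _ = _ := by
        rw [Real.exp_add, mul_comm σ, Real.exp_nat_mul, mul_pow]
        ring

/-- for `σ, w > 0` and `n ≥ 1`,
`∑_{j≥1} e^{-w} (w^j/j!) Γ(σj+n)/Γ(σj) = ∫_0^∞ t^{n-1} e^{-(w+t)} W_{σ,0}(w t^σ) dt`. -/
theorem poisson_gamma_moment_eq_wright_integral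
    (σ w : ℝ) (hσ : 0 < σ) (hw : 0 < w) (n : ℕ) (hn : 1 ≤ n) :
    ∑' j : ℕ, Real.exp (-w) * (w ^ j / (Nat.factorial j : ℝ)) *
        (Real.Gamma (σ * j + n) / Real.Gamma (σ * j)) =
    ∫ t in Set.Ioi (0 : ℝ),
      t ^ ((n : ℝ) - 1) * Real.exp (-(w + t)) * wrightZero σ (w * t ^ σ) := by
  set c : ℕ → ℝ := fun j ↦
    Real.exp (-w) * (w ^ j / (Nat.factorial j : ℝ)) / Real.Gamma (σ * j) with hc
  set F : ℕ → ℝ → ℝ := fun j t ↦ c j * (Real.exp (-t) * t ^ (σ * j + n - 1)) with hF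
  have hpos (j : ℕ) : 0 < σ * j + n := by positivity
  have hc_nonneg (j : ℕ) : 0 ≤ c j := by
    have : 0 ≤ Real.Gamma (σ * j) := Real.Gamma_nonneg_of_nonneg (by positivity)
    positivity
  have hF_integrable (j : ℕ) : Integrable (F j) (volume.restrict (Set.Ioi 0)) :=
    (Real.GammaIntegral_convergent (hpos j)).const_mul (c j)
  have hF_integral (j : ℕ) : ∫ t in Set.Ioi (0 : ℝ), F j t =
      Real.exp (-w) * (w ^ j / (Nat.factorial j : ℝ)) *
        (Real.Gamma (σ * j + n) / Real.Gamma (σ * j)) := by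
    rw [integral_const_mul, ← Real.Gamma_eq_integral (hpos j)]
    simp only [hc]
    ring
  have hF_norm (j : ℕ) : ∫ t in Set.Ioi (0 : ℝ), ‖F j t‖ = ∫ t in Set.Ioi (0 : ℝ), F j t := by
    refine setIntegral_congr_fun measurableSet_Ioi fun t ht ↦ Real.norm_of_nonneg ?_
    have ht : 0 < t := ht
    exact mul_nonneg (hc_nonneg j) (by positivity)
  have hF_summable : Summable fun j ↦ ∫ t in Set.Ioi (0 : ℝ), ‖F j t‖ := by
    simp only [hF_norm, hF_integral]
    exact summable_poisson_mul_Gamma_div_Gamma hσ hw n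
  simp only [← hF_integral]
  rw [integral_tsum_of_summable_integral_norm hF_integrable hF_summable]
  refine setIntegral_congr_fun measurableSet_Ioi fun t ht ↦ ?_
  have ht : 0 < t := ht
  simp only [wrightZero, ← tsum_mul_left]
  refine tsum_congr fun j ↦ ?_
  have hpow : t ^ (σ * j + n - 1) = t ^ ((n : ℝ) - 1) * (t ^ σ) ^ j := by
    rw [← Real.rpow_mul_natCast ht.le, ← Real.rpow_add ht]
    ring_nf
  simp only [hF, hc, hpow, neg_add, Real.exp_add, mul_pow, mul_comm (j : ℝ) σ]
  rw [div_eq_mul_inv, div_eq_mul_inv, div_eq_mul_inv, mul_inv]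
  ring
end

section
/- Let σ > 0 and ζ > 0. For every integer n ≥ 1, every integer k with 1 ≤ k ≤ n, and every tuple of nonnegative integers (x_1,…,x_n) with ∑_{i=1}^n x_i = k and ∑_{i=1}^n i·x_i = n, the NB-CPSM probability equals a mixture of EP-SM probabilities with α = -σ and θ = mσ over a tilted Poisson weight on m: n! / (∑_{j=1}^n 𝒞(n,j;-σ)(-ζ)^j) · ∏_{i=1}^n ((σ(1+σ)_{(i-1)} ζ / i!)^{x_i} / x_i!) = ∑_{m=k}^{∞} [ n! · ((-m)_{(k)} (-1)^k / (mσ)_{(n)}) · ∏_{i=1}^n ((σ(1+σ)_{(i-1)}/i!)^{x_i} / x_i!) ] · p_n(m), where p_n(m) := e^{-ζ} ζ^m Γ(mσ + n) / (m! Γ(mσ) · ∑_{j=1}^n 𝒞(n,j;-σ)(-ζ)^j). -/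
open Finset Filter Real MeasureTheory Topology Set

/-- The ascending factorial of a negative natural number is a signed falling factorial. -/
theorem ascFact_neg_natCast_mul_neg_one_pow (m k : ℕ) :
    ascFact (-(m : ℝ)) k * (-1 : ℝ) ^ k = (m.descFactorial k : ℝ) := by
  induction k with
  | zero => simp [ascFact]
  | succ k ih =>
    have hsucc : ascFact (-(m : ℝ)) (k + 1) = ascFact (-(m : ℝ)) k * (-(m : ℝ) + k) :=
      Finset.prod_range_succ _ _
    rw [hsucc, Nat.descFactorial_succ, Nat.cast_mul, ← ih]
    rcases le_total k m with h | h
    · rw [Nat.cast_sub h]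
      ring
    · rcases h.eq_or_lt with rfl | h
      · simp
      · have hzero : ascFact (-(m : ℝ)) k = 0 :=
          Finset.prod_eq_zero (Finset.mem_range.mpr h) (by simp)
        simp [hzero]

theorem ascFact_pos {x : ℝ} (hx : 0 < x) (n : ℕ) : 0 < ascFact x n :=
  Finset.prod_pos fun i _ => by positivity

theorem Gamma_add_natCast_eq_ascFact_mul {x : ℝ} (hx : 0 < x) (n : ℕ) :
    Real.Gamma (x + n) = ascFact x n * Real.Gamma x := by
  induction n with
  | zero => simp [ascFact]
  | succ n ih =>
    have hsucc : ascFact x (n + 1) = ascFact x n * (x + n) := Finset.prod_range_succ _ _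
    rw [Nat.cast_succ, ← add_assoc, Real.Gamma_add_one (by positivity), ih, hsucc]
    ring

/-- A power of `z` of exponent `∑ i ∈ s, x i` can be distributed over the factors of a product. -/
theorem prod_mul_pow_div_factorial (s : Finset ℕ) (w : ℕ → ℝ) (z : ℝ) (x : ℕ → ℕ) :
    ∏ i ∈ s, (w i * z / (Nat.factorial i : ℝ)) ^ x i / (Nat.factorial (x i) : ℝ) =
      z ^ (∑ i ∈ s, x i) *
        ∏ i ∈ s, (w i / (Nat.factorial i : ℝ)) ^ x i / (Nat.factorial (x i) : ℝ) := by
  rw [← Finset.prod_pow_eq_pow_sum, ← Finset.prod_mul_distrib]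
  refine Finset.prod_congr rfl fun i _ => ?_
  rw [mul_div_right_comm, mul_pow]
  ring

/-- The Poisson distribution has total mass one. -/
theorem hasSum_exp_neg_mul_pow_div_factorial (z : ℝ) :
    HasSum (fun j : ℕ => Real.exp (-z) * (z ^ j / (Nat.factorial j : ℝ))) 1 := by
  have h := (NormedSpace.expSeries_div_hasSum_exp z).mul_left (Real.exp (-z))
  rwa [← Real.exp_eq_exp_ℝ, ← Real.exp_add, neg_add_cancel, Real.exp_zero] at h

/-- for `σ, ζ > 0`, the NB-CPSM probability (with `α = -σ`, `z = -ζ`) of a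
multiplicity vector `(x_1,…,x_n)` with `k` blocks equals the mixture over `m ≥ k` of EP-SM
probabilities with `α = -σ`, `θ = mσ`, with tilted Poisson weights
`p_n(m) = e^{-ζ} ζ^m Γ(mσ+n)/(m! Γ(mσ) ∑_{j=1}^n 𝒞(n,j;-σ)(-ζ)^j)`. -/
theorem nbcpsm_eq_randomized_epsm
    (σ ζ : ℝ) (hσ : 0 < σ) (hζ : 0 < ζ)
    (n : ℕ) (hn : 1 ≤ n) (k : ℕ) (hk1 : 1 ≤ k) (hkn : k ≤ n)
    (x : ℕ → ℕ)
    (hblocks : ∑ i ∈ Finset.Icc 1 n, x i = k)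
    (hsize : ∑ i ∈ Finset.Icc 1 n, i * x i = n) :
    (Nat.factorial n : ℝ) / (∑ j ∈ Finset.Icc 1 n, genFact n j (-σ) * (-ζ) ^ j) *
        ∏ i ∈ Finset.Icc 1 n,
          (σ * ascFact (1 + σ) (i - 1) * ζ / (Nat.factorial i : ℝ)) ^ (x i) /
            (Nat.factorial (x i) : ℝ) =
    ∑' m : ℕ, if k ≤ m then
        ((Nat.factorial n : ℝ) *
            (ascFact (-(m : ℝ)) k * (-1 : ℝ) ^ k / ascFact ((m : ℝ) * σ) n) *
            ∏ i ∈ Finset.Icc 1 n,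
              (σ * ascFact (1 + σ) (i - 1) / (Nat.factorial i : ℝ)) ^ (x i) /
                (Nat.factorial (x i) : ℝ)) *
          (Real.exp (-ζ) * ζ ^ m * Real.Gamma ((m : ℝ) * σ + n) /
            ((Nat.factorial m : ℝ) * Real.Gamma ((m : ℝ) * σ) *
              ∑ j ∈ Finset.Icc 1 n, genFact n j (-σ) * (-ζ) ^ j))
      else 0 := by
  rw [prod_mul_pow_div_factorial _ (fun i => σ * ascFact (1 + σ) (i - 1)), hblocks]
  generalize (∑ j ∈ Finset.Icc 1 n, genFact n j (-σ) * (-ζ) ^ j) = S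
  generalize (∏ i ∈ Finset.Icc 1 n, (σ * ascFact (1 + σ) (i - 1) / (Nat.factorial i : ℝ)) ^ (x i) /
    (Nat.factorial (x i) : ℝ)) = P
  symm
  apply HasSum.tsum_eq
  rw [← (add_left_injective k).hasSum_iff]
  · have hsum := (hasSum_exp_neg_mul_pow_div_factorial ζ).mul_left
      ((Nat.factorial n : ℝ) / S * (ζ ^ k * P))
    rw [mul_one] at hsum
    refine (congrArg (HasSum · _) (funext fun j => ?_)).mpr hsum
    have hm : (0 : ℝ) < ((j + k : ℕ) : ℝ) * σ :=
      mul_pos (Nat.cast_pos.mpr (by omega)) hσ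
    have hfact : (Nat.factorial (j + k) : ℝ) =
        (Nat.factorial j : ℝ) * ((j + k).descFactorial k : ℝ) := by
      have h := Nat.factorial_mul_descFactorial (Nat.le_add_left k j)
      rw [Nat.add_sub_cancel] at h
      exact_mod_cast h.symm
    have hdesc : ((j + k).descFactorial k : ℝ) ≠ 0 :=
      Nat.cast_ne_zero.mpr (Nat.descFactorial_eq_zero_iff_lt.not.mpr (by omega))
    have hasc := (ascFact_pos hm n).ne'
    have hGamma := (Real.Gamma_pos_of_pos hm).ne'
    simp only [Function.comp_apply, Nat.le_add_left, if_true]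
    rw [ascFact_neg_natCast_mul_neg_one_pow, Gamma_add_natCast_eq_ascFact_mul hm, hfact]
    rcases eq_or_ne S 0 with rfl | hS
    · simp
    · field_simp
      ring
  · intro m hm
    exact if_neg fun hkm => hm ⟨m - k, Nat.sub_add_cancel hkm⟩
end
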